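/- arXiv:1112.4892 — 3 statements merged into one kernel-verified Lean document; each statement's English description precedes it below -/
import Mathlib

section
/- There exists a constant c > 0 such that for every sufficiently large prime number N the following holds: for every integer Q ≥ 1, every real M ≥ 1, and every function ψ: ℤ/Nℤ → ℝ all of whose values lie in (2π/Q)ℤ and which satisfies ‖e^{inψ}‖_{A(𝕋_N)} ≤ M for all integers n with 0 ≤ n ≤ Q−1, the set E = {(x,y,z) ∈ (ℤ/Nℤ)³ : ψ(x)+ψ(z−x)−ψ(y)−ψ(z−y) ∈ 2πℤ} satisfies min(card(E)/N³, 1 − card(E)/N³) ≤ c · (log log N / log N)^{1/3} · M². -/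
open scoped Real
open Complex Filter

/-- The Fourier transform on the cyclic group `ℤ/Nℤ`. -/
noncomputable def dftN (N : ℕ) [NeZero N] (g : ZMod N → ℂ) (k : ZMod N) : ℂ :=
  (1 / (N : ℂ)) * ∑ j : ZMod N,
    g j * Complex.exp (-(2 * (π : ℂ) * Complex.I) * (j.val : ℂ) * (k.val : ℂ) / (N : ℂ))

/-- The `A(𝕋_N)` norm on the cyclic group `ℤ/Nℤ`. -/
noncomputable def normAN (N : ℕ) [NeZero N] (g : ZMod N → ℂ) : ℝ :=
  ∑ k : ZMod N, ‖dftN N g k‖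

namespace LevelSet

open Finset

section Characters

variable {p : ℕ} [NeZero p]

/-- The additive character `x ↦ e^{2πikx/p}` of `ℤ/pℤ`. -/
noncomputable def chr (k x : ZMod p) : ℂ := ZMod.stdAddChar (k * x)

lemma norm_chr (k x : ZMod p) : ‖chr k x‖ = 1 := by
  simp only [chr, ZMod.stdAddChar_apply]
  exact Circle.norm_coe _

lemma chr_add_left (k l x : ZMod p) : chr (k + l) x = chr k x * chr l x := by
  simp [chr, add_mul, AddChar.map_add_eq_mul]

lemma chr_add_right (k x y : ZMod p) : chr k (x + y) = chr k x * chr k y := by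
  simp [chr, mul_add, AddChar.map_add_eq_mul]

@[simp] lemma chr_zero_left (x : ZMod p) : chr 0 x = 1 := by simp [chr]

@[simp] lemma chr_zero_right (k : ZMod p) : chr k 0 = 1 := by simp [chr]

lemma conj_chr (k x : ZMod p) : (starRingEnd ℂ) (chr k x) = chr (-k) x := by
  have h : chr k x * chr (-k) x = 1 := by rw [← chr_add_left]; simp
  rw [← Complex.inv_eq_conj (norm_chr k x)]
  exact inv_eq_of_mul_eq_one_right h

lemma chr_neg_right (k x : ZMod p) : chr k (-x) = chr (-k) x := by simp [chr]

lemma chr_eq_exp (k x : ZMod p) :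
    chr k x = Complex.exp (Complex.I * ((2 * π * (k * x).val / p : ℝ) : ℂ)) := by
  rw [chr, ZMod.stdAddChar_apply, ZMod.toCircle_apply]
  congr 1
  push_cast
  ring

lemma norm_one_sub_chr_neg (k x : ZMod p) : ‖1 - chr k (-x)‖ = ‖1 - chr k x‖ := by
  rw [chr_neg_right, ← conj_chr, ← Complex.norm_conj (1 - chr k x)]
  simp

lemma norm_one_sub_chr_add_right_le (k x y : ZMod p) :
    ‖1 - chr k (x + y)‖ ≤ ‖1 - chr k x‖ + ‖1 - chr k y‖ := by
  have h : 1 - chr k (x + y) = (1 - chr k x) + chr k x * (1 - chr k y) := by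
    rw [chr_add_right]; ring
  rw [h]
  refine (norm_add_le _ _).trans ?_
  simp [norm_chr]

lemma norm_one_sub_chr_add_left_le (k l x : ZMod p) :
    ‖1 - chr (k + l) x‖ ≤ ‖1 - chr k x‖ + ‖1 - chr l x‖ := by
  have h : 1 - chr (k + l) x = (1 - chr k x) + chr k x * (1 - chr l x) := by
    rw [chr_add_left]; ring
  rw [h]
  refine (norm_add_le _ _).trans ?_
  simp [norm_chr]

lemma norm_exp_sub_exp_le (a b : ℝ) :
    ‖Complex.exp (Complex.I * a) - Complex.exp (Complex.I * b)‖ ≤ |a - b| := by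
  have h : Complex.exp (Complex.I * a) - Complex.exp (Complex.I * b) =
      Complex.exp (Complex.I * b) * (Complex.exp (Complex.I * ((a - b : ℝ) : ℂ)) - 1) := by
    rw [mul_sub, ← Complex.exp_add]
    push_cast
    ring_nf
  rw [h, norm_mul, mul_comm Complex.I (b : ℂ), Complex.norm_exp_ofReal_mul_I, one_mul]
  exact Real.norm_exp_I_mul_ofReal_sub_one_le

/-- Pigeonhole lower bound for the size of a Bohr set. -/
lemma exists_bohr_set (R : Finset (ZMod p)) {m : ℕ} (hm : 0 < m) :
    ∃ B : Finset (ZMod p), p ≤ B.card * m ^ R.card ∧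
      ∀ x ∈ B, ∀ r ∈ R, ‖1 - chr r x‖ ≤ 2 * π / m := by
  classical
  have hp : 0 < p := Nat.pos_of_neZero p
  let φ : ZMod p → (R → Fin m) := fun x r =>
    ⟨m * (r.1 * x).val / p, by
      rw [Nat.div_lt_iff_lt_mul hp]
      exact Nat.mul_lt_mul_of_pos_left (ZMod.val_lt _) hm⟩
  obtain ⟨c, hc⟩ : ∃ c : R → Fin m, p ≤ (univ.filter (φ · = c)).card * m ^ R.card := by
    by_contra! h
    have h1 : ∑ c : R → Fin m, (univ.filter (φ · = c)).card = p := by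
      rw [← Finset.card_eq_sum_card_fiberwise (fun _ _ => Finset.mem_univ _)]
      simp [ZMod.card]
    have h2 : Fintype.card (R → Fin m) = m ^ R.card := by simp
    have h3 : ∑ c : R → Fin m, (univ.filter (φ · = c)).card * m ^ R.card <
        ∑ c : R → Fin m, p :=
      Finset.sum_lt_sum_of_nonempty ⟨fun _ => ⟨0, hm⟩, mem_univ _⟩ (fun c _ => h c)
    rw [← Finset.sum_mul, h1, Finset.sum_const, Finset.card_univ, h2, smul_eq_mul, mul_comm] at h3
    exact lt_irrefl _ h3
  obtain ⟨x₀, hx₀⟩ : (univ.filter (φ · = c)).Nonempty := by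
    rw [← Finset.card_pos]
    by_contra! h
    rw [Nat.le_zero.1 h] at hc
    omega
  refine ⟨(univ.filter (φ · = c)).image (· - x₀), ?_, ?_⟩
  · rwa [Finset.card_image_of_injective _ (sub_left_injective)]
  · intro y hy r hr
    obtain ⟨x, hx, rfl⟩ := Finset.mem_image.1 hy
    have hφ : φ x = φ x₀ := by simp_all
    have hfl : m * (r * x).val / p = m * (r * x₀).val / p :=
      congrArg Fin.val (congrFun hφ ⟨r, hr⟩)
    have h1 : ‖1 - chr r (x - x₀)‖ = ‖chr r x - chr r x₀‖ := by
      have : chr r x - chr r x₀ = - chr r x₀ * (1 - chr r (x - x₀)) := by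
        have : chr r x = chr r x₀ * chr r (x - x₀) := by rw [← chr_add_right]; congr 1; ring
        rw [this]; ring
      rw [this, norm_mul, norm_neg, norm_chr, one_mul]
    rw [h1, chr_eq_exp, chr_eq_exp]
    refine (norm_exp_sub_exp_le _ _).trans ?_
    generalize (r * x).val = a at *
    generalize (r * x₀).val = b at *
    have hab : |(a : ℝ) - b| * m ≤ p := by
      have ha := Nat.div_add_mod (m * a) p
      have hb := Nat.div_add_mod (m * b) p
      have ha' := Nat.mod_lt (m * a) hp
      have hb' := Nat.mod_lt (m * b) hp
      rw [hfl] at ha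
      have e1 : m * a ≤ m * b + p := by omega
      have e2 : m * b ≤ m * a + p := by omega
      have e1' : (m : ℝ) * a ≤ m * b + p := by exact_mod_cast e1
      have e2' : (m : ℝ) * b ≤ m * a + p := by exact_mod_cast e2
      rw [← abs_of_nonneg (Nat.cast_nonneg m : (0 : ℝ) ≤ m), ← abs_mul, abs_le]
      constructor <;> nlinarith
    have hp' : (0 : ℝ) < p := by exact_mod_cast hp
    have hm' : (0 : ℝ) < m := by exact_mod_cast hm
    have : 2 * π * a / p - 2 * π * b / p = 2 * π * ((a : ℝ) - b) / p := by ring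
    rw [this, abs_div, abs_mul, abs_of_pos Real.two_pi_pos, abs_of_pos hp',
      div_le_div_iff₀ hp' hm', mul_assoc]
    exact mul_le_mul_of_nonneg_left hab Real.two_pi_pos.le

end Characters

section Length

variable {p : ℕ}

/-- A nonnegative, even and subadditive function on `ℤ/pℤ`. -/
structure IsLength (D : ZMod p → ℝ) : Prop where
  nonneg : ∀ x, 0 ≤ D x
  neg : ∀ x, D (-x) = D x
  add_le : ∀ x y, D (x + y) ≤ D x + D y

lemma IsLength.abs_sub_le {D : ZMod p → ℝ} (hD : IsLength D) (x u : ZMod p) :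
    |D (x + u) - D x| ≤ D u := by
  have h1 := hD.add_le x u
  have h2 := hD.add_le (x + u) (-u)
  rw [hD.neg, add_neg_cancel_right] at h2
  rw [abs_le]
  constructor <;> linarith

variable [NeZero p]

/-- The normalising constant of the weight `e^{-D}`. -/
noncomputable def mass (D : ZMod p → ℝ) : ℝ := ∑ x, Real.exp (-D x)

/-- The probability density proportional to `e^{-D}`. -/
noncomputable def gibbs (D : ZMod p → ℝ) (x : ZMod p) : ℝ := Real.exp (-D x) / mass D

lemma mass_pos (D : ZMod p → ℝ) : 0 < mass D :=
  Finset.sum_pos (fun _ _ => Real.exp_pos _) ⟨0, mem_univ _⟩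

lemma gibbs_nonneg (D : ZMod p → ℝ) (x : ZMod p) : 0 ≤ gibbs D x :=
  div_nonneg (Real.exp_pos _).le (mass_pos D).le

lemma sum_gibbs (D : ZMod p → ℝ) : ∑ x, gibbs D x = 1 := by
  simp only [gibbs]
  rw [← Finset.sum_div]
  exact div_self (mass_pos D).ne'

lemma abs_exp_neg_sub_exp_neg_le (a b : ℝ) :
    |Real.exp (-a) - Real.exp (-b)| ≤ |a - b| * (Real.exp (-a) + Real.exp (-b)) := by
  wlog h : a ≤ b generalizing a b
  · have := this b a (le_of_not_ge h)
    rwa [abs_sub_comm, abs_sub_comm a b, add_comm]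
  have h1 : Real.exp (-b) = Real.exp (-a) * Real.exp (a - b) := by
    rw [← Real.exp_add]; ring_nf
  have h2 := Real.add_one_le_exp (a - b)
  have h3 := Real.exp_pos (-a)
  have h4 := Real.exp_pos (-b)
  rw [abs_of_nonneg (sub_nonneg.2 (Real.exp_le_exp.2 (by linarith))), abs_of_nonpos (by linarith)]
  nlinarith

lemma IsLength.sum_abs_gibbs_add_sub_le {D : ZMod p → ℝ} (hD : IsLength D) (u : ZMod p) :
    ∑ x, |gibbs D (x + u) - gibbs D x| ≤ 2 * D u := by
  have h1 : ∀ x, |gibbs D (x + u) - gibbs D x| ≤ D u * (gibbs D (x + u) + gibbs D x) := by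
    intro x
    have h := abs_exp_neg_sub_exp_neg_le (D (x + u)) (D x)
    have h' := hD.abs_sub_le x u
    have hM := mass_pos D
    simp only [gibbs]
    rw [← sub_div, ← add_div, abs_div, abs_of_pos hM, ← mul_div_assoc]
    refine div_le_div_of_nonneg_right (h.trans ?_) hM.le
    exact mul_le_mul_of_nonneg_right h' (by positivity)
  refine (Finset.sum_le_sum fun x _ => h1 x).trans ?_
  have h2 : ∑ x, gibbs D (x + u) = 1 := by
    rw [← sum_gibbs D]
    exact Fintype.sum_equiv (Equiv.addRight u) _ _ fun _ => rfl
  rw [← Finset.mul_sum, Finset.sum_add_distrib, h2, sum_gibbs]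
  linarith

/-- The Gibbs inequality: the mean of a nonnegative function against the density it defines is small
when the normalising constant is large. -/
lemma sum_gibbs_mul_le {D : ZMod p → ℝ} (hD : ∀ x, 0 ≤ D x) {A : ℝ} (hA : 0 < A) :
    ∑ x, gibbs (fun y => A * D y) x * D x ≤ 2 / A * Real.log (p / mass (fun y => A * D y)) := by
  set M := mass (fun y => A * D y) with hM
  have hMpos : 0 < M := mass_pos _
  have hp : (0 : ℝ) < p := by exact_mod_cast Nat.pos_of_neZero p
  set l := Real.log (p / M)
  have hl : Real.exp (-l) = M / p := by
    rw [Real.exp_neg, Real.exp_log (div_pos hp hMpos), inv_div]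
  have h1 : ∀ x, gibbs (fun y => A * D y) x * (A / 2 * D x) ≤
      gibbs (fun y => A * D y) x * (l - 1) + 1 / p := by
    intro x
    have h := Real.add_one_le_exp (A / 2 * D x - l)
    have hg := gibbs_nonneg (fun y => A * D y) x
    have h2 : gibbs (fun y => A * D y) x * Real.exp (A / 2 * D x - l) ≤ 1 / p := by
      have : gibbs (fun y => A * D y) x * Real.exp (A / 2 * D x - l) =
          Real.exp (-(A / 2 * D x)) / p := by
        simp only [gibbs]
        rw [← hM, sub_eq_add_neg, Real.exp_add, hl,
          show -(A * D x) = -(A / 2 * D x) + -(A / 2 * D x) by ring, Real.exp_add, Real.exp_neg]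
        have := Real.exp_pos (A / 2 * D x)
        field_simp
      rw [this]
      refine div_le_div_of_nonneg_right ?_ hp.le
      rw [Real.exp_le_one_iff]
      have := mul_nonneg hA.le (hD x)
      linarith
    nlinarith
  have h2 := Finset.sum_le_sum fun x (_ : x ∈ (univ : Finset (ZMod p))) => h1 x
  rw [Finset.sum_add_distrib, ← Finset.sum_mul, sum_gibbs] at h2
  have h3 : ∑ _x : ZMod p, 1 / (p : ℝ) = 1 := by
    simp [ZMod.card, hp.ne']
  have h4 : ∑ x, gibbs (fun y => A * D y) x * (A / 2 * D x) =
      A / 2 * ∑ x, gibbs (fun y => A * D y) x * D x := by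
    rw [Finset.mul_sum]
    exact Finset.sum_congr rfl fun x _ => by ring
  rw [h3, h4] at h2
  calc _ = 2 / A * (A / 2 * ∑ x, gibbs (fun y => A * D y) x * D x) := by field_simp
    _ ≤ 2 / A * l := mul_le_mul_of_nonneg_left (by linarith) (by positivity)

end Length
section LocalSpectrum

variable {p : ℕ} [NeZero p]

/-- A local average with respect to an almost translation-invariant density takes a value close to
the global average. -/
lemma exists_local_average_near [Fact p.Prime] {D : ZMod p → ℝ} (hD : IsLength D)
    {f : ZMod p → ℝ} (hf : ∀ x, |f x| ≤ 1) {α : ℝ} (hα : ∑ x, f x = p * α) {t : ZMod p}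
    (ht : t ≠ 0) {ε : ℝ} (hε : 2 * D t ≤ ε) :
    ∃ x₀, |∑ y, gibbs D y * f (x₀ + y) - α| ≤ ε := by
  set F : ZMod p → ℝ := fun x => ∑ y, gibbs D y * f (x + y) with hF
  have hstep : ∀ x, |F (x + t) - F x| ≤ ε := by
    intro x
    have h1 : F (x + t) = ∑ y, gibbs D (y + -t) * f (x + y) := by
      refine Fintype.sum_equiv (Equiv.addRight t) _ _ fun y => ?_
      simp [add_assoc, add_comm t y]
    rw [h1, hF, ← Finset.sum_sub_distrib]
    refine (Finset.abs_sum_le_sum_abs _ _).trans (le_trans ?_ hε)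
    rw [← hD.neg t]
    refine le_trans (Finset.sum_le_sum fun y _ => ?_) (hD.sum_abs_gibbs_add_sub_le (-t))
    rw [← sub_mul, abs_mul]
    exact mul_le_of_le_one_right (abs_nonneg _) (hf _)
  have hsum : ∑ x, F x = ∑ _x : ZMod p, α := by
    simp only [hF]
    rw [Finset.sum_comm]
    have : ∀ y, ∑ x, gibbs D y * f (x + y) = gibbs D y * (p * α) := by
      intro y
      rw [← Finset.mul_sum, ← hα]
      congr 1
      exact Fintype.sum_equiv (Equiv.addRight y) _ _ fun _ => rfl
    simp_rw [this]
    rw [← Finset.sum_mul, sum_gibbs]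
    simp [ZMod.card]
  obtain ⟨x, -, hx⟩ := Finset.exists_le_of_sum_le (univ_nonempty) hsum.le
  obtain ⟨x', -, hx'⟩ := Finset.exists_le_of_sum_le (univ_nonempty) hsum.ge
  by_contra! h
  have hlow : ∀ n : ℕ, F (x + n * t) < α := by
    intro n
    induction n with
    | zero =>
      have := h x
      simp only [Nat.cast_zero, zero_mul, add_zero]
      refine lt_of_le_of_ne hx fun h0 => ?_
      have h2 := (abs_nonneg _).trans (hstep x)
      change ε < |F x - α| at this
      rw [h0, sub_self, abs_zero] at this
      linarith
    | succ n ih =>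
      have h1 := h (x + n * t)
      have h2 := hstep (x + n * t)
      change ε < |F (x + n * t) - α| at h1
      rw [abs_of_neg (by linarith)] at h1
      rw [abs_le] at h2
      have h3 := h (x + n * t + t)
      change ε < |F (x + n * t + t) - α| at h3
      push_cast
      rw [add_mul, one_mul, ← add_assoc]
      linarith [h2.2]
  have h1 := hlow ((x' - x) * t⁻¹).val
  rw [ZMod.natCast_zmod_val, mul_assoc, inv_mul_cancel₀ ht, mul_one, add_sub_cancel] at h1
  linarith

/-- Removing from an indicator function some frequencies that are almost constant locally, together
with frequencies of small total mass, leaves a function that is not small in local `L²`. -/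
lemma local_energy_lower_bound {w f : ZMod p → ℝ} (hw : ∀ y, 0 ≤ w y) (hw1 : ∑ y, w y = 1)
    (hf : ∀ x, f x = 0 ∨ f x = 1) {a : ZMod p → ℂ} {K : ℝ} (hK : 1 ≤ K) (ha : ∑ k, ‖a k‖ ≤ K)
    (hfa : ∀ x, (f x : ℂ) = ∑ k, a k * chr k x) {α ε : ℝ} (hα0 : 0 ≤ α) (hα1 : α ≤ 1)
    {x₀ : ZMod p} (hx₀ : |∑ y, w y * f (x₀ + y) - α| ≤ ε) (hε : 32 * K * ε ≤ α * (1 - α))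
    {S N : Finset (ZMod p)} (hSN : Disjoint S N)
    (hS : ∀ s ∈ S, ∑ y, w y * ‖1 - chr s y‖ ≤ ε) (hN : ∑ s ∈ N, ‖a s‖ ≤ 1 / 8) :
    α * (1 - α) / 4 ≤ ∑ y, w y * ‖∑ s ∈ (S ∪ N)ᶜ, a s * chr s (x₀ + y)‖ ^ 2 := by
  classical
  have hε0 : 0 ≤ ε := (abs_nonneg _).trans hx₀
  have hSK : ∑ s ∈ S, ‖a s‖ ≤ K :=
    (Finset.sum_le_univ_sum_of_nonneg fun _ => norm_nonneg _).trans ha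
  set c : ℂ := ∑ s ∈ S, a s * chr s x₀ with hc
  set h : ZMod p → ℂ := fun y => ∑ s ∈ S, a s * chr s x₀ * (chr s y - 1) with hh
  set n : ZMod p → ℂ := fun y => ∑ s ∈ N, a s * chr s (x₀ + y) with hn
  set g : ZMod p → ℂ := fun y => ∑ s ∈ (S ∪ N)ᶜ, a s * chr s (x₀ + y) with hg
  have hcK : ‖c‖ ≤ K := by
    refine (norm_sum_le _ _).trans (le_trans (Finset.sum_le_sum fun s _ => ?_) hSK)
    rw [norm_mul, norm_chr, mul_one]
  have hnb : ∀ y, ‖n y‖ ≤ 1 / 8 := by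
    intro y
    refine (norm_sum_le _ _).trans (le_trans (Finset.sum_le_sum fun s _ => ?_) hN)
    rw [norm_mul, norm_chr, mul_one]
  have hhb : ∑ y, w y * ‖h y‖ ≤ K * ε := by
    have h1 : ∀ y, w y * ‖h y‖ ≤ ∑ s ∈ S, ‖a s‖ * (w y * ‖1 - chr s y‖) := by
      intro y
      have : ‖h y‖ ≤ ∑ s ∈ S, ‖a s‖ * ‖1 - chr s y‖ := by
        refine (norm_sum_le _ _).trans (Finset.sum_le_sum fun s _ => ?_)
        rw [norm_mul, norm_mul, norm_chr, mul_one, norm_sub_rev]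
      refine (mul_le_mul_of_nonneg_left this (hw y)).trans_eq ?_
      rw [Finset.mul_sum]
      exact Finset.sum_congr rfl fun s _ => by ring
    refine (Finset.sum_le_sum fun y _ => h1 y).trans ?_
    rw [Finset.sum_comm]
    calc _ ≤ ∑ s ∈ S, ‖a s‖ * ε := by
            refine Finset.sum_le_sum fun s hs => ?_
            rw [← Finset.mul_sum]
            exact mul_le_mul_of_nonneg_left (hS s hs) (norm_nonneg _)
      _ ≤ K * ε := by
            rw [← Finset.sum_mul]
            exact mul_le_mul_of_nonneg_right hSK hε0
  have hdec : ∀ y, g y = f (x₀ + y) - c - h y - n y := by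
    intro y
    have h1 : c + h y = ∑ s ∈ S, a s * chr s (x₀ + y) := by
      rw [hc, hh, ← Finset.sum_add_distrib]
      refine Finset.sum_congr rfl fun s _ => ?_
      rw [chr_add_right]; ring
    have h2 := Finset.sum_compl_add_sum (S ∪ N) fun s => a s * chr s (x₀ + y)
    rw [Finset.sum_union hSN, ← h1, ← hfa] at h2
    rw [← h2]
    simp only [hg, hn]
    ring
  have hpt : ∀ y, (1 - α) * f (x₀ + y) - c.re * (f (x₀ + y) - α) - ‖h y‖
      - 1 / 8 * (α + (1 - 2 * α) * f (x₀ + y)) - ((1 - 2 * α) * f (x₀ + y) + α ^ 2) / 4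
      ≤ ‖g y‖ ^ 2 := by
    intro y
    have h1 : (g y).re = f (x₀ + y) - c.re - (h y).re - (n y).re := by
      rw [hdec]; simp
    have h2 : (g y).re ^ 2 ≤ ‖g y‖ ^ 2 := by
      rw [← sq_abs]
      exact pow_le_pow_left₀ (abs_nonneg _) (Complex.abs_re_le_norm _) 2
    have h3 := abs_le.1 (Complex.abs_re_le_norm (h y))
    have h4 := abs_le.1 ((Complex.abs_re_le_norm (n y)).trans (hnb y))
    have h6 := norm_nonneg (h y)
    rcases hf (x₀ + y) with hfy | hfy <;> rw [hfy] at h1 ⊢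
    · have h5 := sq_nonneg ((g y).re + α / 2)
      have e1 : (h y).re * α ≥ -‖h y‖ := by nlinarith
      have e2 : (n y).re * α ≥ -(1 / 8 * α) := by nlinarith
      rw [h1] at h5 h2
      nlinarith
    · have h5 := sq_nonneg ((g y).re - (1 - α) / 2)
      have e1 : (h y).re * (1 - α) ≤ ‖h y‖ := by nlinarith
      have e2 : (n y).re * (1 - α) ≤ 1 / 8 * (1 - α) := by nlinarith
      rw [h1] at h5 h2
      nlinarith
  set m := ∑ y, w y * f (x₀ + y) with hm
  have hsum : (1 - α) * m - c.re * (m - α) - ∑ y, w y * ‖h y‖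
      - 1 / 8 * (α + (1 - 2 * α) * m) - ((1 - 2 * α) * m + α ^ 2) / 4
      ≤ ∑ y, w y * ‖g y‖ ^ 2 := by
    refine le_trans (le_of_eq ?_)
      (Finset.sum_le_sum fun y _ => mul_le_mul_of_nonneg_left (hpt y) (hw y))
    have : ∀ y, w y * ((1 - α) * f (x₀ + y) - c.re * (f (x₀ + y) - α) - ‖h y‖
        - 1 / 8 * (α + (1 - 2 * α) * f (x₀ + y)) - ((1 - 2 * α) * f (x₀ + y) + α ^ 2) / 4) =
        ((1 - α) - c.re - 1 / 8 * (1 - 2 * α) - (1 - 2 * α) / 4) * (w y * f (x₀ + y))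
        + (c.re * α - 1 / 8 * α - α ^ 2 / 4) * w y - w y * ‖h y‖ := by
      intro y; ring
    simp_rw [this]
    rw [Finset.sum_sub_distrib, Finset.sum_add_distrib, ← Finset.mul_sum, ← Finset.mul_sum, hw1,
      ← hm]
    ring
  refine le_trans ?_ hsum
  have hcr := (Complex.abs_re_le_norm c).trans hcK
  have e1 : c.re * (m - α) ≤ K * ε := by
    refine (le_abs_self _).trans ?_
    rw [abs_mul]
    exact mul_le_mul hcr hx₀ (abs_nonneg _) (by linarith)
  rw [abs_le] at hx₀
  have e2 : (1 - α) * m ≥ (1 - α) * α - ε := by nlinarith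
  have e3 : (1 - 2 * α) * m ≤ (1 - 2 * α) * α + ε := by
    have : (1 - 2 * α) * (m - α) ≤ ε := by
      refine (le_abs_self _).trans ?_
      rw [abs_mul]
      have e4 : |1 - 2 * α| ≤ 1 := by rw [abs_le]; constructor <;> linarith
      have e5 : |m - α| ≤ ε := abs_le.2 hx₀
      nlinarith [abs_nonneg (1 - 2 * α), abs_nonneg (m - α)]
    linarith
  nlinarith

/-- A function that is not small in local `L²` has a cluster of frequencies of large mass. -/
lemma exists_spectral_cluster {w : ZMod p → ℝ} {a : ZMod p → ℂ} {K : ℝ} (hK : 0 < K)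
    (ha : ∑ k, ‖a k‖ ≤ K) {v : ℝ} {x₀ : ZMod p} {T : Finset (ZMod p)}
    (hw : ∀ y, 0 ≤ w y) (hw1 : ∑ y, w y = 1)
    (hv : v / 4 ≤ ∑ y, w y * ‖∑ s ∈ T, a s * chr s (x₀ + y)‖ ^ 2) :
    ∃ r, v / (8 * K) ≤
      ∑ s ∈ T with v / (8 * K ^ 2) ≤ ‖∑ y, w y * chr (r - s) y‖, ‖a s‖ := by
  classical
  set g : ZMod p → ℂ := fun y => ∑ s ∈ T, a s * chr s (x₀ + y) with hg
  have hTK : ∑ s ∈ T, ‖a s‖ ≤ K :=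
    (Finset.sum_le_univ_sum_of_nonneg fun _ => norm_nonneg _).trans ha
  obtain ⟨r, hr⟩ :=
    Finite.exists_max fun r : ZMod p => ‖∑ y, w y * chr r y * (starRingEnd ℂ) (g y)‖
  set B := ‖∑ y, w y * chr r y * (starRingEnd ℂ) (g y)‖ with hB
  have h1 : ((∑ y, w y * ‖g y‖ ^ 2 : ℝ) : ℂ) =
      ∑ s ∈ T, a s * chr s x₀ * ∑ y, w y * chr s y * (starRingEnd ℂ) (g y) := by
    simp_rw [Finset.mul_sum]
    rw [Finset.sum_comm]
    push_cast
    refine Finset.sum_congr rfl fun y _ => ?_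
    rw [← Complex.mul_conj']
    conv_lhs => rw [hg]
    simp only
    rw [Finset.sum_mul, Finset.mul_sum]
    refine Finset.sum_congr rfl fun s _ => ?_
    rw [chr_add_right]
    ring
  have h2 : v / 4 ≤ K * B := by
    refine hv.trans ((le_abs_self _).trans ?_)
    rw [← Real.norm_eq_abs, ← Complex.norm_real, h1]
    refine (norm_sum_le _ _).trans ?_
    calc _ ≤ ∑ s ∈ T, ‖a s‖ * B := by
            refine Finset.sum_le_sum fun s _ => ?_
            rw [norm_mul, norm_mul, norm_chr, mul_one]
            exact mul_le_mul_of_nonneg_left (hr s) (norm_nonneg _)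
      _ ≤ K * B := by
            rw [← Finset.sum_mul]
            exact mul_le_mul_of_nonneg_right hTK (norm_nonneg _)
  have h3 : B ≤ ∑ s ∈ T, ‖a s‖ * ‖∑ y, w y * chr (r - s) y‖ := by
    have : ∑ y, w y * chr r y * (starRingEnd ℂ) (g y) =
        ∑ s ∈ T, (starRingEnd ℂ) (a s * chr s x₀) * ∑ y, w y * chr (r - s) y := by
      simp_rw [Finset.mul_sum]
      rw [Finset.sum_comm]
      refine Finset.sum_congr rfl fun y _ => ?_
      simp only [hg]
      rw [map_sum, Finset.mul_sum]
      refine Finset.sum_congr rfl fun s _ => ?_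
      rw [chr_add_right, ← mul_assoc, map_mul, conj_chr s y, sub_eq_add_neg, chr_add_left]
      ring
    rw [hB, this]
    refine (norm_sum_le _ _).trans (Finset.sum_le_sum fun s _ => ?_)
    rw [norm_mul, Complex.norm_conj, norm_mul, norm_chr, mul_one]
  have h4 : ∀ k, ‖∑ y, (w y : ℂ) * chr k y‖ ≤ 1 := by
    intro k
    rw [← hw1]
    refine (norm_sum_le _ _).trans (Finset.sum_le_sum fun y _ => ?_)
    rw [norm_mul, norm_chr, mul_one, Complex.norm_real, Real.norm_of_nonneg (hw y)]
  have hv0 : 0 ≤ v ∨ v ≤ 0 := le_total _ _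
  refine ⟨r, ?_⟩
  rcases hv0 with hv0 | hv0
  swap
  · exact (div_nonpos_of_nonpos_of_nonneg hv0 (by positivity)).trans
      (Finset.sum_nonneg fun _ _ => norm_nonneg _)
  have h5 : B ≤ (∑ s ∈ T with v / (8 * K ^ 2) ≤ ‖∑ y, w y * chr (r - s) y‖, ‖a s‖) +
      v / (8 * K ^ 2) * K := by
    refine h3.trans ?_
    rw [← Finset.sum_filter_add_sum_filter_not T
      (fun s => v / (8 * K ^ 2) ≤ ‖∑ y, w y * chr (r - s) y‖)]
    refine add_le_add (Finset.sum_le_sum fun s _ => ?_) ?_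
    · exact mul_le_of_le_one_right (norm_nonneg _) (h4 _)
    · calc _ ≤ ∑ s ∈ T with ¬ v / (8 * K ^ 2) ≤ ‖∑ y, w y * chr (r - s) y‖,
                v / (8 * K ^ 2) * ‖a s‖ := by
              refine Finset.sum_le_sum fun s hs => ?_
              rw [mul_comm]
              exact mul_le_mul_of_nonneg_right (not_le.1 (Finset.mem_filter.1 hs).2).le
                (norm_nonneg _)
        _ ≤ v / (8 * K ^ 2) * K := by
              rw [← Finset.mul_sum]
              refine mul_le_mul_of_nonneg_left ?_ (by positivity)
              exact (Finset.sum_le_univ_sum_of_nonneg fun _ => norm_nonneg _).trans ha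
  have h6 : v / (8 * K ^ 2) * K = v / (8 * K) := by field_simp
  have h7 : v / (4 * K) ≤ B := by
    rw [div_le_iff₀ (by positivity)]
    linarith
  have h8 : v / (4 * K) = v / (8 * K) + v / (8 * K) := by field_simp; ring
  linarith

/-- Large Fourier coefficients of an almost invariant density belong to almost trivial
characters. -/
lemma IsLength.norm_one_sub_chr_le {D : ZMod p → ℝ} (hD : IsLength D) {τ : ℝ} (hτ : 0 < τ)
    {k : ZMod p} (hk : τ ≤ ‖∑ y, (gibbs D y : ℂ) * chr k y‖) (u : ZMod p) :
    ‖1 - chr k u‖ ≤ 2 / τ * D u := by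
  have h1 : (∑ y, (gibbs D y : ℂ) * chr k y) * (1 - chr k u) =
      ∑ y, ((gibbs D (y + u) - gibbs D y : ℝ) : ℂ) * chr k (y + u) := by
    have h2 : ∑ y, (gibbs D y : ℂ) * chr k y = ∑ y, (gibbs D (y + u) : ℂ) * chr k (y + u) :=
      (Fintype.sum_equiv (Equiv.addRight u) _ _ fun _ => rfl).symm
    rw [mul_sub, mul_one]
    nth_rewrite 1 [h2]
    rw [Finset.sum_mul, ← Finset.sum_sub_distrib]
    refine Finset.sum_congr rfl fun y _ => ?_
    rw [chr_add_right]
    push_cast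
    ring
  have h3 : ‖(∑ y, (gibbs D y : ℂ) * chr k y) * (1 - chr k u)‖ ≤ 2 * D u := by
    rw [h1]
    refine (norm_sum_le _ _).trans
      (le_trans (Finset.sum_le_sum fun y _ => ?_) (hD.sum_abs_gibbs_add_sub_le u))
    rw [norm_mul, norm_chr, mul_one, Complex.norm_real, Real.norm_eq_abs]
  rw [norm_mul] at h3
  have h4 := mul_le_mul_of_nonneg_right hk (norm_nonneg (1 - chr k u))
  rw [div_mul_eq_mul_div, le_div_iff₀ hτ]
  linarith

end LocalSpectrum
section Iteration

variable {p : ℕ} [NeZero p]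

/-- A length function dominated by few characters has a short nonzero vector, and the density it
defines is concentrated where the length is small. -/
lemma IsLength.exists_short_and_concentrated {D : ZMod p → ℝ} (hD : IsLength D)
    {R : Finset (ZMod p)} {W : ℝ} (hW : 0 ≤ W) (hDW : ∀ u, D u ≤ W * ∑ r ∈ R, ‖1 - chr r u‖)
    {m : ℕ} (hm : 0 < m) (hmp : m ^ R.card < p) {A ε : ℝ} (hA : 0 < A) (hε : ε ≤ 2)
    (hAε : A * (W * (R.card * (2 * π / m))) ≤ ε / 2)
    (hlog : 2 / A * (1 + R.card * Real.log m) ≤ ε) :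
    (∃ t, t ≠ 0 ∧ 2 * (A * D t) ≤ ε) ∧ ∑ y, gibbs (fun x => A * D x) y * D y ≤ ε := by
  obtain ⟨B, hB, hBR⟩ := exists_bohr_set R hm
  have hshort : ∀ x ∈ B, A * D x ≤ ε / 2 := by
    intro x hx
    refine le_trans (mul_le_mul_of_nonneg_left ?_ hA.le) hAε
    refine (hDW x).trans (mul_le_mul_of_nonneg_left ?_ hW)
    rw [← nsmul_eq_mul]
    exact Finset.sum_le_card_nsmul _ _ _ (hBR x hx)
  have hp : 0 < p := Nat.pos_of_neZero p
  refine ⟨?_, ?_⟩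
  · have hB1 : 1 < B.card := by
      by_contra! h
      have := Nat.mul_le_mul_right (m ^ R.card) h
      omega
    obtain ⟨t, ht, ht0⟩ := Finset.exists_mem_ne hB1 0
    exact ⟨t, ht0, by linarith [hshort t ht]⟩
  · refine (sum_gibbs_mul_le hD.nonneg hA).trans (le_trans ?_ hlog)
    refine mul_le_mul_of_nonneg_left ?_ (by positivity)
    have hM : B.card * Real.exp (-1) ≤ mass (fun y => A * D y) := by
      rw [← nsmul_eq_mul]
      refine (Finset.card_nsmul_le_sum B (fun y => Real.exp (-(A * D y))) _ fun y hy => ?_).trans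
        (Finset.sum_le_univ_sum_of_nonneg fun _ => (Real.exp_pos _).le)
      exact Real.exp_le_exp.2 (by linarith [hshort y hy])
    have hm' : (0 : ℝ) < m := by exact_mod_cast hm
    have hp' : (0 : ℝ) < p := by exact_mod_cast hp
    have hBp : (p : ℝ) ≤ B.card * (m : ℝ) ^ R.card := by exact_mod_cast hB
    rw [Real.log_le_iff_le_exp (div_pos hp' (mass_pos _)), div_le_iff₀ (mass_pos _), Real.exp_add,
      Real.exp_nat_mul, Real.exp_log hm']
    calc (p : ℝ) ≤ Real.exp 1 * (m : ℝ) ^ R.card * (B.card * Real.exp (-1)) := by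
          refine hBp.trans_eq ?_
          rw [Real.exp_neg]
          have := Real.exp_pos 1
          field_simp
      _ ≤ _ := mul_le_mul_of_nonneg_left hM (by positivity)

variable [Fact p.Prime] {f : ZMod p → ℝ} {a : ZMod p → ℂ} {K α ε : ℝ}

/-- A set of frequencies of mass at least `1 / 8`, outside the locally constant ones, is covered by
few clusters. -/
lemma exists_captured_block (hf : ∀ x, f x = 0 ∨ f x = 1) (hK : 1 ≤ K) (ha : ∑ k, ‖a k‖ ≤ K)
    (hfa : ∀ x, (f x : ℂ) = ∑ k, a k * chr k x) (hα : ∑ x, f x = p * α)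
    (hα0 : 0 < α) (hα1 : α < 1) (hε : 32 * K * ε ≤ α * (1 - α))
    {D : ZMod p → ℝ} (hD : IsLength D) {t : ZMod p} (ht : t ≠ 0) (htε : 2 * D t ≤ ε)
    {S : Finset (ZMod p)} (hS : ∀ s ∈ S, ∑ y, gibbs D y * ‖1 - chr s y‖ ≤ ε) :
    ∃ R N : Finset (ZMod p), Disjoint S N ∧ 1 / 8 ≤ ∑ s ∈ N, ‖a s‖ ∧
      R.card * (α * (1 - α) / (8 * K)) ≤ ∑ s ∈ N, ‖a s‖ ∧
      ∀ s ∈ N, ∃ r ∈ R, ∀ u,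
        ‖1 - chr s u‖ ≤ ‖1 - chr r u‖ + 16 * K ^ 2 / (α * (1 - α)) * D u := by
  classical
  have hv : 0 < α * (1 - α) := mul_pos hα0 (by linarith)
  have hf1 : ∀ x, |f x| ≤ 1 := fun x => by rcases hf x with h | h <;> simp [h]
  obtain ⟨x₀, hx₀⟩ := exists_local_average_near hD hf1 hα ht htε
  let P : Finset (ZMod p) × Finset (ZMod p) → Prop := fun X => Disjoint S X.2 ∧
      X.1.card * (α * (1 - α) / (8 * K)) ≤ ∑ s ∈ X.2, ‖a s‖ ∧
      ∀ s ∈ X.2, ∃ r ∈ X.1, ∀ u,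
        ‖1 - chr s u‖ ≤ ‖1 - chr r u‖ + 16 * K ^ 2 / (α * (1 - α)) * D u
  obtain ⟨⟨R, N⟩, hX, hmax⟩ := Finset.exists_max_image (univ.filter P) (fun X => ∑ s ∈ X.2, ‖a s‖)
    ⟨(∅, ∅), by simp [P]⟩
  obtain ⟨hSN, hR, hcov⟩ := (Finset.mem_filter.1 hX).2
  refine ⟨R, N, hSN, ?_, hR, hcov⟩
  by_contra! hN
  have henergy := local_energy_lower_bound (gibbs_nonneg D) (sum_gibbs D) hf hK ha hfa hα0.le hα1.le
    hx₀ hε hSN hS hN.le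
  obtain ⟨r, hr⟩ := exists_spectral_cluster (by linarith) ha (gibbs_nonneg D) (sum_gibbs D) henergy
  set N' := (S ∪ N)ᶜ.filter fun s =>
    α * (1 - α) / (8 * K ^ 2) ≤ ‖∑ y, (gibbs D y : ℂ) * chr (r - s) y‖ with hN'
  have hdisj : Disjoint (S ∪ N) N' :=
    disjoint_compl_right.mono_right (Finset.filter_subset _ _)
  rw [Finset.disjoint_union_left] at hdisj
  have hsum : ∑ s ∈ N ∪ N', ‖a s‖ = ∑ s ∈ N, ‖a s‖ + ∑ s ∈ N', ‖a s‖ :=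
    Finset.sum_union hdisj.2
  have hη : 0 < α * (1 - α) / (8 * K) := by positivity
  have hP : P (insert r R, N ∪ N') := by
    refine ⟨Finset.disjoint_union_right.2 ⟨hSN, hdisj.1⟩, ?_, ?_⟩
    · have : ((insert r R).card : ℝ) ≤ R.card + 1 := by exact_mod_cast Finset.card_insert_le r R
      simp only at hR ⊢
      rw [hsum]
      nlinarith
    · intro s hs
      rcases Finset.mem_union.1 hs with hs | hs
      · obtain ⟨r', hr', h⟩ := hcov s hs
        exact ⟨r', Finset.mem_insert_of_mem hr', h⟩
      · refine ⟨r, Finset.mem_insert_self _ _, fun u => ?_⟩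
        have h1 := hD.norm_one_sub_chr_le (by positivity) (Finset.mem_filter.1 hs).2 u
        have h2 := norm_one_sub_chr_add_left_le r (-(r - s)) u
        rw [← chr_neg_right (r - s) u, norm_one_sub_chr_neg, ← sub_eq_add_neg, sub_sub_cancel] at h2
        have h3 : 2 / (α * (1 - α) / (8 * K ^ 2)) = 16 * K ^ 2 / (α * (1 - α)) := by
          field_simp; norm_num
        rw [h3] at h1
        linarith
  have := hmax _ (Finset.mem_filter.2 ⟨mem_univ _, hP⟩)
  simp only at this
  linarith

/-- The iteration: at each stage a further block of frequencies becomes locally constant. -/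
lemma exists_capture_stage (hf : ∀ x, f x = 0 ∨ f x = 1) (hK : 1 ≤ K) (ha : ∑ k, ‖a k‖ ≤ K)
    (hfa : ∀ x, (f x : ℂ) = ∑ k, a k * chr k x) (hα : ∑ x, f x = p * α)
    (hα0 : 0 < α) (hα1 : α < 1) (hε : 32 * K * ε ≤ α * (1 - α)) {A L : ℝ} (hA : 0 < A)
    (hL1 : 1 ≤ L) (hL : 16 * K ^ 2 / (α * (1 - α)) * A ≤ L) {m : ℕ} (hm : 0 < m)
    (hmp : ∀ d : ℕ, d ≤ 8 * K ^ 2 / (α * (1 - α)) → m ^ d < p)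
    (hAε : ∀ d j : ℕ, d ≤ 8 * K ^ 2 / (α * (1 - α)) → j ≤ 8 * K →
      A * ((2 * L) ^ j * (d * (2 * π / m))) ≤ ε / 2)
    (hlog : ∀ d : ℕ, d ≤ 8 * K ^ 2 / (α * (1 - α)) → 2 / A * (1 + d * Real.log m) ≤ ε) (j : ℕ) :
    ∃ (D : ZMod p → ℝ) (S R : Finset (ZMod p)), IsLength D ∧
      (∀ s ∈ S, ∀ u, ‖1 - chr s u‖ ≤ D u) ∧
      (∀ u, D u ≤ (2 * L) ^ j * ∑ r ∈ R, ‖1 - chr r u‖) ∧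
      R.card * (α * (1 - α) / (8 * K)) ≤ ∑ s ∈ S, ‖a s‖ ∧ (j : ℝ) / 8 ≤ ∑ s ∈ S, ‖a s‖ := by
  classical
  have hv : 0 < α * (1 - α) := mul_pos hα0 (by linarith)
  induction j with
  | zero =>
    refine ⟨fun _ => 0, ∅, ∅, ⟨by simp, by simp, by simp⟩, by simp, by simp, by simp, by simp⟩
  | succ j ih =>
    obtain ⟨D, S, R, hD, hSD, hDR, hR, hj⟩ := ih
    have hSK : ∑ s ∈ S, ‖a s‖ ≤ K :=
      (Finset.sum_le_univ_sum_of_nonneg fun _ => norm_nonneg _).trans ha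
    have hRd : (R.card : ℝ) ≤ 8 * K ^ 2 / (α * (1 - α)) := by
      rw [le_div_iff₀ hv]
      have h := hR.trans hSK
      rw [← mul_div_assoc, div_le_iff₀ (by positivity)] at h
      linarith
    have hj8 : (j : ℝ) ≤ 8 * K := by linarith
    have hε2 : ε ≤ 2 := by nlinarith [sq_nonneg (α - 1 / 2)]
    obtain ⟨⟨t, ht0, ht⟩, hconc⟩ := hD.exists_short_and_concentrated (by positivity) hDR hm
      (hmp _ hRd) hA hε2 (hAε _ _ hRd hj8) (hlog _ hRd)
    have hAD : IsLength fun u => A * D u :=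
      ⟨fun x => mul_nonneg hA.le (hD.nonneg x), fun x => by simp only [hD.neg], fun x y => by
        rw [← mul_add]; exact mul_le_mul_of_nonneg_left (hD.add_le x y) hA.le⟩
    have hSε : ∀ s ∈ S, ∑ y, gibbs (fun u => A * D u) y * ‖1 - chr s y‖ ≤ ε := fun s hs =>
      (Finset.sum_le_sum fun y _ =>
        mul_le_mul_of_nonneg_left (hSD s hs y) (gibbs_nonneg _ y)).trans hconc
    obtain ⟨R', N, hSN, hN, hR', hcov⟩ :=
      exists_captured_block hf hK ha hfa hα hα0 hα1 hε hAD ht0 ht hSε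
    have hsum : ∑ s ∈ S ∪ N, ‖a s‖ = ∑ s ∈ S, ‖a s‖ + ∑ s ∈ N, ‖a s‖ := Finset.sum_union hSN
    have hnn : ∀ (X : Finset (ZMod p)) (u : ZMod p), 0 ≤ ∑ r ∈ X, ‖1 - chr r u‖ :=
      fun X u => Finset.sum_nonneg fun _ _ => norm_nonneg _
    refine ⟨fun u => L * D u + ∑ r ∈ R', ‖1 - chr r u‖, S ∪ N, R ∪ R', ⟨?_, ?_, ?_⟩, ?_, ?_, ?_, ?_⟩
    · exact fun x => add_nonneg (mul_nonneg (by linarith) (hD.nonneg x)) (hnn _ _)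
    · intro x
      simp only [hD.neg, norm_one_sub_chr_neg]
    · intro x y
      have h1 := mul_le_mul_of_nonneg_left (hD.add_le x y) (by linarith : (0 : ℝ) ≤ L)
      have h2 : ∑ r ∈ R', ‖1 - chr r (x + y)‖ ≤
          ∑ r ∈ R', ‖1 - chr r x‖ + ∑ r ∈ R', ‖1 - chr r y‖ := by
        rw [← Finset.sum_add_distrib]
        exact Finset.sum_le_sum fun r _ => norm_one_sub_chr_add_right_le r x y
      linarith
    · intro s hs u
      rcases Finset.mem_union.1 hs with hs | hs
      · have h1 := hSD s hs u
        have h2 := hD.nonneg u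
        have h3 := hnn R' u
        nlinarith
      · obtain ⟨r, hr, h⟩ := hcov s hs
        have h1 := h u
        have h2 : ‖1 - chr r u‖ ≤ ∑ r ∈ R', ‖1 - chr r u‖ :=
          Finset.single_le_sum (f := fun r => ‖1 - chr r u‖) (fun _ _ => norm_nonneg _) hr
        have h3 := mul_le_mul_of_nonneg_right hL (hD.nonneg u)
        linarith
    · intro u
      have h1 : ∑ r ∈ R, ‖1 - chr r u‖ ≤ ∑ r ∈ R ∪ R', ‖1 - chr r u‖ :=
        Finset.sum_le_sum_of_subset_of_nonneg Finset.subset_union_left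
          fun _ _ _ => norm_nonneg _
      have h2 : ∑ r ∈ R', ‖1 - chr r u‖ ≤ ∑ r ∈ R ∪ R', ‖1 - chr r u‖ :=
        Finset.sum_le_sum_of_subset_of_nonneg Finset.subset_union_right
          fun _ _ _ => norm_nonneg _
      have h3 : (1 : ℝ) ≤ (2 * L) ^ j := one_le_pow₀ (by linarith)
      set σ := ∑ r ∈ R ∪ R', ‖1 - chr r u‖
      have h4 : D u ≤ (2 * L) ^ j * σ :=
        (hDR u).trans (mul_le_mul_of_nonneg_left h1 (by positivity))
      have h5 := mul_le_mul_of_nonneg_left h4 (by linarith : (0 : ℝ) ≤ L)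
      have h6 : σ ≤ L * ((2 * L) ^ j * σ) := by
        rw [← mul_assoc]
        exact le_mul_of_one_le_left (hnn _ _) (one_le_mul_of_one_le_of_one_le hL1 h3)
      calc _ ≤ L * ((2 * L) ^ j * σ) + L * ((2 * L) ^ j * σ) := by linarith
        _ = _ := by rw [pow_succ]; ring
    · have h1 : ((R ∪ R').card : ℝ) ≤ R.card + R'.card := by
        exact_mod_cast Finset.card_union_le R R'
      have h2 := mul_le_mul_of_nonneg_right h1
        (by positivity : 0 ≤ α * (1 - α) / (8 * K))
      rw [hsum]
      linarith
    · rw [hsum]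
      push_cast
      linarith

/-- A quantitative form of the Green–Konyagin theorem: if an indicator function with mean `α` on
`ℤ/pℤ` has Wiener norm at most `K`, then `p` is bounded in terms of `K` and `K / (α (1 - α))`. -/
theorem prime_le_of_wiener_norm_le (hf : ∀ x, f x = 0 ∨ f x = 1) (hK : 1 ≤ K)
    (ha : ∑ k, ‖a k‖ ≤ K) (hfa : ∀ x, (f x : ℂ) = ∑ k, a k * chr k x)
    (hα : ∑ x, f x = p * α) (hα0 : 0 < α) (hα1 : α < 1) {q : ℕ} (hq : 50000 ≤ q) (hKq : K ≤ q)
    (hKv : K ≤ q * (α * (1 - α))) : p ≤ q ^ (720 * q ^ 3) := by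
  by_contra! hp
  have hv : 0 < α * (1 - α) := mul_pos hα0 (by linarith)
  have hqR : (50000 : ℝ) ≤ q := by exact_mod_cast hq
  have hq0 : (0 : ℝ) < q := by linarith
  have hq1 : (1 : ℝ) ≤ q := by linarith
  have hKK : K ^ 2 / (α * (1 - α)) ≤ (q : ℝ) ^ 2 := by
    rw [div_le_iff₀ hv]
    nlinarith
  have hd : ∀ d : ℕ, (d : ℝ) ≤ 8 * K ^ 2 / (α * (1 - α)) → d ≤ 8 * q ^ 2 := by
    intro d h
    have : (d : ℝ) ≤ 8 * (q : ℝ) ^ 2 := by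
      rw [mul_div_assoc] at h
      linarith
    exact_mod_cast this
  have hstage := exists_capture_stage (ε := 1 / (32 * q)) (A := (q : ℝ) ^ 6) (L := (q : ℝ) ^ 9)
    (m := q ^ (90 * q)) hf hK ha hfa hα hα0 hα1 ?_ (by positivity) (one_le_pow₀ hq1) ?_
    (by positivity) ?_ ?_ ?_ (⌊8 * K⌋₊ + 1)
  · obtain ⟨-, S, -, -, -, -, -, h⟩ := hstage
    have h1 : ∑ s ∈ S, ‖a s‖ ≤ K :=
      (Finset.sum_le_univ_sum_of_nonneg fun _ => norm_nonneg _).trans ha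
    have h2 := Nat.lt_floor_add_one (8 * K)
    push_cast at h
    linarith
  · rw [mul_one_div, div_le_iff₀ (by positivity)]
    nlinarith
  · rw [mul_div_assoc]
    calc 16 * (K ^ 2 / (α * (1 - α))) * (q : ℝ) ^ 6 ≤ q * q ^ 2 * (q : ℝ) ^ 6 := by
          gcongr
          linarith
      _ = _ := by ring
  · intro d h
    refine lt_of_le_of_lt ?_ hp
    rw [← pow_mul]
    refine Nat.pow_le_pow_right (by omega) ?_
    calc 90 * q * d ≤ 90 * q * (8 * q ^ 2) := Nat.mul_le_mul_left _ (hd d h)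
      _ = _ := by ring
  · intro d j h hj
    have hdR : (d : ℝ) ≤ 8 * q ^ 2 := by exact_mod_cast hd d h
    have hjq : j ≤ 8 * q := by
      have : (j : ℝ) ≤ 8 * q := by linarith
      exact_mod_cast this
    have h1 : (2 * (q : ℝ) ^ 9) ^ j ≤ (q : ℝ) ^ (80 * q) := by
      calc (2 * (q : ℝ) ^ 9) ^ j ≤ (q * (q : ℝ) ^ 9) ^ j := by
            gcongr
            linarith
        _ = (q : ℝ) ^ (10 * j) := by rw [← pow_succ', ← pow_mul]
        _ ≤ _ := pow_le_pow_right₀ hq1 (by omega)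
    have hπ : 2 * π ≤ 8 := by linarith [Real.pi_le_four]
    push_cast
    have h2 : (q : ℝ) ^ 6 * ((2 * (q : ℝ) ^ 9) ^ j * (d * (2 * π / (q : ℝ) ^ (90 * q)))) ≤
        q ^ 6 * (q ^ (80 * q) * (8 * q ^ 2 * (8 / q ^ (90 * q)))) := by
      gcongr
    refine h2.trans ?_
    have h3 : (q : ℝ) ^ (90 * q) = q ^ (80 * q) * q ^ (10 * q) := by rw [← pow_add]; ring_nf
    have h4 : (q : ℝ) ^ 10 ≤ q ^ (10 * q) := pow_le_pow_right₀ hq1 (by omega)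
    have h5 : (q : ℝ) ^ 6 * (q ^ (80 * q) * (8 * q ^ 2 * (8 / q ^ (90 * q)))) =
        64 * q ^ 8 / q ^ (10 * q) := by
      rw [h3]
      field_simp
      ring
    rw [h5, div_div, div_le_div_iff₀ (by positivity) (by positivity)]
    calc 64 * (q : ℝ) ^ 8 * (32 * q * 2) = 4096 * (q : ℝ) ^ 9 := by ring
      _ ≤ q * (q : ℝ) ^ 9 := by gcongr; linarith
      _ = 1 * (q : ℝ) ^ 10 := by ring
      _ ≤ _ := by linarith
  · intro d h
    have hdR : (d : ℝ) ≤ 8 * q ^ 2 := by exact_mod_cast hd d h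
    have hlog : Real.log ((q ^ (90 * q) : ℕ) : ℝ) ≤ 90 * q ^ 2 := by
      push_cast
      rw [Real.log_pow]
      have := Real.log_le_sub_one_of_pos hq0
      push_cast
      nlinarith
    have hlog0 : 0 ≤ Real.log ((q ^ (90 * q) : ℕ) : ℝ) := Real.log_natCast_nonneg _
    have h1 : 1 + d * Real.log ((q ^ (90 * q) : ℕ) : ℝ) ≤ 721 * (q : ℝ) ^ 4 := by
      have h2 : d * Real.log ((q ^ (90 * q) : ℕ) : ℝ) ≤ 8 * q ^ 2 * (90 * q ^ 2) := by gcongr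
      have h3 : (1 : ℝ) ≤ (q : ℝ) ^ 4 := one_le_pow₀ hq1
      nlinarith
    calc 2 / (q : ℝ) ^ 6 * (1 + d * Real.log ((q ^ (90 * q) : ℕ) : ℝ)) ≤
          2 / (q : ℝ) ^ 6 * (721 * (q : ℝ) ^ 4) := by gcongr
      _ = 1442 / ((q : ℝ) * q) := by field_simp; ring
      _ ≤ 1 / (32 * (q : ℝ)) := by
          rw [div_le_div_iff₀ (by positivity) (by positivity)]
          nlinarith

end Iteration
section Asymptotics

lemma mul_one_sub_ge_half_min {α : ℝ} (h0 : 0 ≤ α) (h1 : α ≤ 1) :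
    min α (1 - α) / 2 ≤ α * (1 - α) := by
  rcases le_total α (1 - α) with h | h
  · rw [min_eq_left h]; nlinarith
  · rw [min_eq_right h]; nlinarith

/-- For large `n` there is an integer `q` of order `(log n / log log n)^{1/3}` such that
`q ^ (720 q³) < n`. -/
lemma exists_nat_pow_lt : ∃ N₀ : ℕ, ∀ n : ℕ, N₀ ≤ n → ∃ q : ℕ, 50000 ≤ q ∧
    q ^ (720 * q ^ 3) < n ∧ 0 < Real.log (Real.log n) / Real.log n ∧
    1 ≤ 20 * (Real.log (Real.log n) / Real.log n) ^ ((1 : ℝ) / 3) * q := by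
  have hlog : Tendsto (fun n : ℕ => Real.log n) atTop atTop :=
    Real.tendsto_log_atTop.comp tendsto_natCast_atTop_atTop
  have hC : (0 : ℝ) < (2000000 ^ 3)⁻¹ := by norm_num
  have e1 := hlog.eventually (Real.isLittleO_log_id_atTop.bound hC)
  have e2 := (Real.tendsto_log_atTop.comp hlog).eventually_ge_atTop 1
  have e3 := hlog.eventually_ge_atTop 1
  obtain ⟨N₀, hN₀⟩ := eventually_atTop.1 ((e1.and (e2.and e3)).and (eventually_ge_atTop 1))
  refine ⟨N₀, fun n hn => ?_⟩
  obtain ⟨⟨h1, h2, h3⟩, h4⟩ := hN₀ n hn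
  simp only [Function.comp_apply, id] at h1 h2
  set L := Real.log n with hL
  set l := Real.log L with hl
  have hL0 : 0 < L := by linarith
  have hl0 : 0 < l := by linarith
  rw [Real.norm_of_nonneg hl0.le, Real.norm_of_nonneg hL0.le] at h1
  set X := (L / l) ^ ((1 : ℝ) / 3) with hX
  have hX0 : 0 < X := Real.rpow_pos_of_pos (div_pos hL0 hl0) _
  have hX3 : X ^ 3 = L / l := by
    rw [hX, ← Real.rpow_natCast, ← Real.rpow_mul (div_pos hL0 hl0).le]
    norm_num
  have hXbig : 2000000 ≤ X := by
    have : (2000000 : ℝ) ^ 3 ≤ X ^ 3 := by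
      rw [hX3, le_div_iff₀ hl0]
      rw [inv_mul_eq_div, le_div_iff₀ (by norm_num)] at h1
      linarith
    exact le_of_pow_le_pow_left₀ (by norm_num) hX0.le this
  have hinv : (l / L) ^ ((1 : ℝ) / 3) = X⁻¹ := by
    rw [hX, ← Real.inv_rpow (div_pos hL0 hl0).le, inv_div]
  have hq1 : (⌊X / 10⌋₊ : ℝ) ≤ X / 10 := Nat.floor_le (by positivity)
  have hq2 := Nat.lt_floor_add_one (X / 10)
  set q := ⌊X / 10⌋₊ with hq
  have hq3 : X / 20 ≤ q := by linarith
  have hq4 : (50000 : ℝ) ≤ q := by linarith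
  have hq5 : 50000 ≤ q := by exact_mod_cast hq4
  refine ⟨q, hq5, ?_, div_pos hl0 hL0, ?_⟩
  · have hn : (0 : ℝ) < n := by exact_mod_cast h4
    have : ((q ^ (720 * q ^ 3) : ℕ) : ℝ) < n := by
      rw [← Real.log_lt_log_iff (by positivity) hn]
      push_cast
      rw [Real.log_pow]
      push_cast
      have hlogX : Real.log X ≤ l / 3 := by
        have h5 : 3 * Real.log X = Real.log (L / l) := by rw [← hX3, Real.log_pow]; norm_num
        have h6 : Real.log (L / l) ≤ l :=
          Real.log_le_log (div_pos hL0 hl0) (div_le_self hL0.le h2)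
        linarith
      have hlogq : Real.log q ≤ l / 3 :=
        (Real.log_le_log (by linarith) (by linarith)).trans hlogX
      have hlogq0 : 0 ≤ Real.log q := Real.log_natCast_nonneg _
      calc 720 * (q : ℝ) ^ 3 * Real.log q ≤ 720 * (X / 10) ^ 3 * (l / 3) := by gcongr
        _ = 24 / 100 * (X ^ 3 * l) := by ring
        _ = 24 / 100 * L := by rw [hX3, div_mul_cancel₀ _ hl0.ne']
        _ < L := by linarith
    exact_mod_cast this
  · rw [hinv]
    have : 20 * X⁻¹ * (X / 20) = 1 := by field_simp
    rw [← this]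
    gcongr

end Asymptotics

section WienerAlgebra

variable {p : ℕ} [NeZero p]

/-- The function `g` is a combination of characters with coefficients of total modulus at
most `K`. -/
def WienerLE (g : ZMod p → ℂ) (K : ℝ) : Prop :=
  ∃ a : ZMod p → ℂ, ∑ k, ‖a k‖ ≤ K ∧ ∀ x, g x = ∑ k, a k * chr k x

lemma sum_dftN_mul_chr (g : ZMod p → ℂ) (x : ZMod p) : ∑ k, dftN p g k * chr k x = g x := by
  have h1 : ∀ k, dftN p g k = (p : ℂ)⁻¹ * ZMod.dft g k := by
    intro k
    rw [dftN, ZMod.dft_apply, one_div]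
    congr 1
    refine Finset.sum_congr rfl fun j _ => ?_
    have h : -(j * k) = ((-((j.val : ℤ) * k.val) : ℤ) : ZMod p) := by
      push_cast
      simp
    rw [h, ZMod.stdAddChar_coe, smul_eq_mul, mul_comm]
    congr 2
    push_cast
    ring
  have h2 := congrFun (ZMod.dft.symm_apply_apply g) x
  rw [ZMod.invDFT_apply, smul_eq_mul, Finset.mul_sum] at h2
  rw [← h2]
  refine Finset.sum_congr rfl fun k _ => ?_
  rw [h1, chr, smul_eq_mul]
  ring

lemma wienerLE_of_normAN_le {g : ZMod p → ℂ} {K : ℝ} (h : normAN p g ≤ K) : WienerLE g K :=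
  ⟨dftN p g, h, fun x => (sum_dftN_mul_chr g x).symm⟩

lemma WienerLE.nonneg {g : ZMod p → ℂ} {K : ℝ} (hg : WienerLE g K) : 0 ≤ K := by
  obtain ⟨a, ha, -⟩ := hg
  exact (Finset.sum_nonneg fun _ _ => norm_nonneg _).trans ha

lemma WienerLE.mul {g h : ZMod p → ℂ} {K L : ℝ} (hg : WienerLE g K) (hh : WienerLE h L) :
    WienerLE (fun x => g x * h x) (K * L) := by
  have hK := hg.nonneg
  obtain ⟨a, ha, hga⟩ := hg
  obtain ⟨b, hb, hhb⟩ := hh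
  refine ⟨fun m => ∑ k, a k * b (m - k), ?_, fun x => ?_⟩
  · calc ∑ m, ‖∑ k, a k * b (m - k)‖ ≤ ∑ m, ∑ k, ‖a k‖ * ‖b (m - k)‖ := by
          refine Finset.sum_le_sum fun m _ => (norm_sum_le _ _).trans_eq ?_
          simp
      _ = (∑ k, ‖a k‖) * ∑ l, ‖b l‖ := by
          rw [Finset.sum_comm, Finset.sum_mul]
          refine Finset.sum_congr rfl fun k _ => ?_
          rw [← Finset.mul_sum]
          congr 1
          exact Fintype.sum_equiv (Equiv.subRight k) _ _ fun _ => rfl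
      _ ≤ K * L := mul_le_mul ha hb (Finset.sum_nonneg fun _ _ => norm_nonneg _) hK
  · simp only
    rw [hga, hhb, Finset.sum_mul]
    simp_rw [Finset.sum_mul]
    rw [Finset.sum_comm (s := univ) (t := univ) (f := fun m k => a k * b (m - k) * chr m x)]
    refine Finset.sum_congr rfl fun k _ => ?_
    rw [Finset.mul_sum]
    refine (Fintype.sum_equiv (Equiv.subRight k) _ _ fun m => ?_).symm
    have : chr m x = chr k x * chr (m - k) x := by rw [← chr_add_left, add_sub_cancel]
    rw [this, Equiv.subRight_apply]
    ring

lemma WienerLE.const_mul {g : ZMod p → ℂ} {K : ℝ} (hg : WienerLE g K) {c : ℂ} (hc : ‖c‖ ≤ 1) :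
    WienerLE (fun x => c * g x) K := by
  obtain ⟨a, ha, hga⟩ := hg
  refine ⟨fun k => c * a k, le_trans (Finset.sum_le_sum fun k _ => ?_) ha, fun x => ?_⟩
  · rw [norm_mul]
    exact mul_le_of_le_one_left (norm_nonneg _) hc
  · simp only
    rw [hga, Finset.mul_sum]
    exact Finset.sum_congr rfl fun k _ => by ring

lemma WienerLE.conj {g : ZMod p → ℂ} {K : ℝ} (hg : WienerLE g K) :
    WienerLE (fun x => (starRingEnd ℂ) (g x)) K := by
  obtain ⟨a, ha, hga⟩ := hg
  refine ⟨fun k => (starRingEnd ℂ) (a (-k)), le_trans (le_of_eq ?_) ha, fun x => ?_⟩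
  · simp_rw [Complex.norm_conj]
    exact Fintype.sum_equiv (Equiv.neg _) _ _ fun _ => rfl
  · simp only
    rw [hga, map_sum]
    refine Fintype.sum_equiv (Equiv.neg _) _ _ fun k => ?_
    rw [map_mul, conj_chr]
    simp

lemma WienerLE.comp_sub_right {g : ZMod p → ℂ} {K : ℝ} (hg : WienerLE g K) (y : ZMod p) :
    WienerLE (fun x => g (x - y)) K := by
  obtain ⟨a, ha, hga⟩ := hg
  refine ⟨fun k => a k * chr k (-y), le_trans (le_of_eq ?_) ha, fun x => ?_⟩
  · simp_rw [norm_mul, norm_chr, mul_one]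
  · simp only
    rw [hga]
    refine Finset.sum_congr rfl fun k _ => ?_
    rw [sub_eq_add_neg, chr_add_right]
    ring

lemma WienerLE.comp_sub_left {g : ZMod p → ℂ} {K : ℝ} (hg : WienerLE g K) (z : ZMod p) :
    WienerLE (fun x => g (z - x)) K := by
  obtain ⟨a, ha, hga⟩ := hg
  refine ⟨fun k => a (-k) * chr (-k) z, le_trans (le_of_eq ?_) ha, fun x => ?_⟩
  · simp_rw [norm_mul, norm_chr, mul_one]
    exact Fintype.sum_equiv (Equiv.neg _) _ _ fun _ => rfl
  · simp only
    rw [hga]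
    refine Fintype.sum_equiv (Equiv.neg _) _ _ fun k => ?_
    rw [sub_eq_add_neg, chr_add_right, chr_neg_right, Equiv.neg_apply, neg_neg]
    ring

lemma WienerLE.average {ι : Type*} {s : Finset ι} (hs : s.Nonempty) {g : ι → ZMod p → ℂ} {K : ℝ}
    (hg : ∀ i ∈ s, WienerLE (g i) K) :
    WienerLE (fun x => (s.card : ℂ)⁻¹ * ∑ i ∈ s, g i x) K := by
  choose! a ha hga using hg
  have hs0 : (0 : ℝ) < s.card := by exact_mod_cast hs.card_pos
  refine ⟨fun k => (s.card : ℂ)⁻¹ * ∑ i ∈ s, a i k, ?_, fun x => ?_⟩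
  · simp_rw [norm_mul, norm_inv, Complex.norm_natCast]
    rw [← Finset.mul_sum, inv_mul_le_iff₀ hs0]
    calc _ ≤ ∑ k, ∑ i ∈ s, ‖a i k‖ := Finset.sum_le_sum fun k _ => norm_sum_le _ _
      _ = ∑ i ∈ s, ∑ k, ‖a i k‖ := Finset.sum_comm
      _ ≤ ∑ _i ∈ s, K := Finset.sum_le_sum ha
      _ = _ := by simp
  · simp only
    simp_rw [mul_assoc, Finset.sum_mul]
    rw [← Finset.mul_sum, Finset.sum_comm]
    congr 1
    exact Finset.sum_congr rfl fun i hi => hga i hi x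

end WienerAlgebra

/-- **Green–Konyagin**: a subset of `ℤ/pℤ` whose indicator function has small Wiener norm has
density close to `0` or `1`. -/
theorem exists_min_density_le : ∃ N₀ : ℕ, ∀ (p : ℕ) [NeZero p], p.Prime → N₀ ≤ p →
    ∀ (P : ZMod p → Prop) [DecidablePred P] (K : ℝ), 1 ≤ K →
      WienerLE (fun x => if P x then 1 else 0) K →
      min ((#{x | P x} : ℝ) / p) (1 - (#{x | P x} : ℝ) / p) ≤
        40 * (Real.log (Real.log p) / Real.log p) ^ ((1 : ℝ) / 3) * K := by
  obtain ⟨N₀, hN₀⟩ := exists_nat_pow_lt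
  refine ⟨N₀, fun p _ hp hN P _ K hK hP => ?_⟩
  have : Fact p.Prime := ⟨hp⟩
  obtain ⟨q, hq, hqp, hpos, hqX⟩ := hN₀ p hN
  obtain ⟨a, ha, hPa⟩ := hP
  have hp0 : (0 : ℝ) < p := by exact_mod_cast hp.pos
  set α : ℝ := (#{x | P x} : ℝ) / p with hα
  set X := (Real.log (Real.log p) / Real.log p) ^ ((1 : ℝ) / 3)
  have hX : 0 < X := Real.rpow_pos_of_pos hpos _
  have hα0 : 0 ≤ α := by positivity
  have hα1 : α ≤ 1 := by
    rw [hα, div_le_one hp0]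
    have := Finset.card_le_univ (univ.filter P)
    rw [ZMod.card] at this
    exact_mod_cast this
  by_contra! h
  have hXK : 0 < 40 * X * K := by positivity
  have hmin0 := hXK.trans h
  have hv := mul_one_sub_ge_half_min hα0 hα1
  have hq0 : (0 : ℝ) ≤ q := Nat.cast_nonneg q
  have hKv : K ≤ q * (α * (1 - α)) := by
    have h1 : K * 1 ≤ K * (20 * X * q) := mul_le_mul_of_nonneg_left hqX (by linarith)
    have h2 := mul_le_mul_of_nonneg_left (h.le.trans (by linarith : _ ≤ 2 * (α * (1 - α)))) hq0
    linarith
  have hKq : K ≤ q := by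
    refine hKv.trans (mul_le_of_le_one_right hq0 ?_)
    nlinarith
  refine absurd (prime_le_of_wiener_norm_le (f := fun x => if P x then 1 else 0) (a := a) (α := α)
    (fun x => ?_) hK ha (fun x => ?_) ?_ (hmin0.trans_le (min_le_left _ _))
    (by linarith [hmin0.trans_le (min_le_right _ _)]) hq hKq hKv) (not_le.2 hqp)
  · by_cases hx : P x <;> simp [hx]
  · rw [← hPa]
    by_cases hx : P x <;> simp [hx]
  · rw [hα, mul_div_cancel₀ _ hp0.ne']
    simp

section Ternary

variable {G : Type*} [Fintype G] {ε : ℝ}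

open Classical in
/-- If every class of an equivalence relation has density at most `ε` or at least `1 - ε`, then the
relation is close to a constant. -/
lemma exists_sum_abs_sub_le {R : G → G → Prop} (hR : Equivalence R)
    (h : ∀ y, (#{x | R x y} : ℝ) ≤ ε * Fintype.card G ∨
      (1 - ε) * Fintype.card G ≤ (#{x | R x y} : ℝ)) (hε : 0 ≤ ε) :
    ∃ ζ : ℝ, ∑ q : G × G, |(if R q.1 q.2 then 1 else 0) - ζ| ≤ 2 * ε * Fintype.card G ^ 2 := by
  set n : ℝ := (Fintype.card G : ℝ) with hn
  by_cases hsmall : ∀ y, (#{x | R x y} : ℝ) ≤ ε * n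
  · refine ⟨0, ?_⟩
    have h1 : ∀ x y, |(if R x y then (1 : ℝ) else 0) - 0| = if R x y then 1 else 0 := by
      intro x y
      split_ifs <;> simp
    simp_rw [h1, Fintype.sum_prod_type_right, Finset.sum_boole]
    calc _ ≤ ∑ _y : G, ε * n := Finset.sum_le_sum fun y _ => hsmall y
      _ = n * (ε * n) := by simp [hn]
      _ ≤ _ := by nlinarith [mul_nonneg hε (sq_nonneg n)]
  · push Not at hsmall
    obtain ⟨y₀, hy₀⟩ := hsmall
    have hC := (h y₀).resolve_left (not_le.2 hy₀)
    refine ⟨1, ?_⟩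
    have h1 : ∀ x y, |(if R x y then (1 : ℝ) else 0) - 1| ≤
        (1 - if R x y₀ then 1 else 0) + (1 - if R y y₀ then 1 else 0) := by
      intro x y
      by_cases hx : R x y₀ <;> by_cases hy : R y y₀
      · simp [hx, hy, hR.trans hx (hR.symm hy)]
      all_goals by_cases hxy : R x y <;> simp [hx, hy, hxy]
    set u : G → ℝ := fun x => if R x y₀ then 1 else 0
    have hu : ∑ x, u x = #{x | R x y₀} := Finset.sum_boole _ _
    calc _ ≤ ∑ q : G × G, ((1 - u q.1) + (1 - u q.2)) :=
          Finset.sum_le_sum fun q _ => h1 q.1 q.2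
      _ = 2 * n * (n - #{x | R x y₀}) := by
        rw [Finset.sum_add_distrib, Fintype.sum_prod_type, Fintype.sum_prod_type]
        simp only [Finset.sum_sub_distrib, Finset.sum_const, Finset.card_univ, nsmul_eq_mul,
          ← Finset.mul_sum, hu, mul_one, ← hn]
        ring
      _ ≤ 2 * n * (ε * n) := mul_le_mul_of_nonneg_left (by linarith) (by positivity)
      _ = _ := by ring

open Classical in
/-- A ternary relation that is an equivalence in its first two variables and all of whose slices in
the first and in the third variable have density close to `0` or `1` has density close to `0` or
`1`. -/
lemma min_density_ternary_le [Nonempty G] {E : G → G → G → Prop}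
    (hE : ∀ z, Equivalence fun x y => E x y z)
    (h₁ : ∀ y z, min ((#{x | E x y z} : ℝ) / Fintype.card G)
      (1 - (#{x | E x y z} : ℝ) / Fintype.card G) ≤ ε)
    (h₃ : ∀ x y, min ((#{z | E x y z} : ℝ) / Fintype.card G)
      (1 - (#{z | E x y z} : ℝ) / Fintype.card G) ≤ ε) (hε : 0 ≤ ε) :
    min ((#{q : G × G × G | E q.1 q.2.1 q.2.2} : ℝ) / Fintype.card G ^ 3)
      (1 - (#{q : G × G × G | E q.1 q.2.1 q.2.2} : ℝ) / Fintype.card G ^ 3) ≤ 5 * ε := by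
  set n : ℝ := (Fintype.card G : ℝ) with hn
  have hn0 : 0 < n := by simp [hn, Fintype.card_pos]
  have hslice : ∀ s : ℝ, min (s / n) (1 - s / n) ≤ ε → s ≤ ε * n ∨ (1 - ε) * n ≤ s := by
    intro s hs
    rcases min_le_iff.1 hs with h | h
    · exact .inl ((div_le_iff₀ hn0).1 h)
    · exact .inr ((le_div_iff₀ hn0).1 (by linarith))
  choose ζ hζ using fun z => exists_sum_abs_sub_le (hE z) (fun y => hslice _ (h₁ y z)) hε
  set e : G → G → G → ℝ := fun x y z => if E x y z then 1 else 0 with he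
  have htotal : ∑ q : G × G, ∑ z, |e q.1 q.2 z - ζ z| ≤ 2 * ε * n ^ 3 := by
    rw [Finset.sum_comm]
    calc _ ≤ ∑ _z : G, 2 * ε * n ^ 2 := Finset.sum_le_sum fun z _ => hζ z
      _ = _ := by
        simp only [Finset.sum_const, Finset.card_univ, nsmul_eq_mul, ← hn]
        ring
  obtain ⟨q, -, hq⟩ : ∃ q ∈ (univ : Finset (G × G)),
      ∑ z, |e q.1 q.2 z - ζ z| ≤ 2 * ε * n := by
    refine Finset.exists_le_of_sum_le univ_nonempty (htotal.trans_eq ?_)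
    simp only [Finset.sum_const, Finset.card_univ, nsmul_eq_mul, Fintype.card_prod, Nat.cast_mul,
      ← hn]
    ring
  have hsq : |(#{z | E q.1 q.2 z} : ℝ) - ∑ z, ζ z| ≤ 2 * ε * n := by
    refine le_trans ?_ hq
    rw [← Finset.sum_boole, ← Finset.sum_sub_distrib]
    exact Finset.abs_sum_le_sum_abs _ _
  have hst : |(#{q : G × G × G | E q.1 q.2.1 q.2.2} : ℝ) - n ^ 2 * ∑ z, ζ z| ≤ 2 * ε * n ^ 3 := by
    refine le_trans ?_ htotal
    have h2 : n ^ 2 * ∑ z, ζ z = ∑ _q : G × G, ∑ z, ζ z := by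
      simp only [Finset.sum_const, Finset.card_univ, nsmul_eq_mul, Fintype.card_prod,
        Nat.cast_mul, ← hn]
      ring
    have h3 : (#{q : G × G × G | E q.1 q.2.1 q.2.2} : ℝ) = ∑ q : G × G, ∑ z, e q.1 q.2 z := by
      rw [← Finset.sum_boole, Fintype.sum_prod_type, Fintype.sum_prod_type]
      exact Finset.sum_congr rfl fun x _ => Fintype.sum_prod_type _
    rw [h2, h3, ← Finset.sum_sub_distrib]
    simp_rw [← Finset.sum_sub_distrib]
    exact (Finset.abs_sum_le_sum_abs _ _).trans
      (Finset.sum_le_sum fun _ _ => Finset.abs_sum_le_sum_abs _ _)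
  rw [abs_le] at hsq hst
  have hn3 : 0 < n ^ 3 := by positivity
  have hn2 : 0 ≤ n ^ 2 := by positivity
  rcases hslice _ (h₃ q.1 q.2) with h | h
  · refine min_le_of_left_le ((div_le_iff₀ hn3).2 ?_)
    have h4 : n ^ 2 * ∑ z, ζ z ≤ n ^ 2 * (3 * ε * n) :=
      mul_le_mul_of_nonneg_left (by linarith) hn2
    linarith
  · refine min_le_of_right_le ?_
    rw [sub_le_comm, le_div_iff₀ hn3]
    have h4 : n ^ 2 * ((1 - 3 * ε) * n) ≤ n ^ 2 * ∑ z, ζ z :=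
      mul_le_mul_of_nonneg_left (by linarith) hn2
    linarith

end Ternary

section RootsOfUnity

/-- Averaging over the `Q`-th roots of unity detects the multiples of `2π` among the multiples of
`2π / Q`. -/
lemma average_exp_eq_ite {Q : ℕ} (hQ : 0 < Q) {θ : ℝ} {m : ℤ} (hθ : θ = 2 * π / Q * m)
    [Decidable (∃ k : ℤ, θ = 2 * π * k)] :
    ((range Q).card : ℂ)⁻¹ * ∑ n ∈ range Q, exp (I * n * θ) =
      if ∃ k : ℤ, θ = 2 * π * k then 1 else 0 := by
  have hQ0 : (Q : ℂ) ≠ 0 := by exact_mod_cast hQ.ne'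
  have hpow : ∀ n : ℕ, exp (I * n * θ) = exp (I * θ) ^ n := fun n => by
    rw [← Complex.exp_nat_mul]
    ring_nf
  simp_rw [hpow, card_range]
  have hone : exp (I * θ) = 1 ↔ ∃ k : ℤ, θ = 2 * π * k := by
    rw [Complex.exp_eq_one_iff]
    refine exists_congr fun k => ?_
    rw [← Complex.ofReal_inj]
    push_cast
    constructor <;> intro h
    · exact mul_left_cancel₀ I_ne_zero (by rw [h]; ring)
    · rw [h]; ring
  split_ifs with h
  · rw [hone.2 h]
    simp [hQ0]
  · have hne : exp (I * θ) ≠ 1 := fun h' => h (hone.1 h')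
    have hQpow : exp (I * θ) ^ Q = 1 := by
      rw [← Complex.exp_nat_mul, Complex.exp_eq_one_iff]
      refine ⟨m, ?_⟩
      rw [hθ]
      push_cast
      field_simp
    rw [geom_sum_eq hne, hQpow]
    simp

end RootsOfUnity

section Slices

lemma equivalence_exists_sub_eq {p : ℕ} (ψ : ZMod p → ℝ) (z : ZMod p) :
    Equivalence fun x y => ∃ m : ℤ, ψ x + ψ (z - x) - ψ y - ψ (z - y) = 2 * π * m where
  refl x := ⟨0, by simp⟩
  symm := by
    rintro x y ⟨m, hm⟩
    exact ⟨-m, by push_cast; linarith⟩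
  trans := by
    rintro x y w ⟨m, hm⟩ ⟨k, hk⟩
    exact ⟨m + k, by push_cast; linarith⟩

variable {p : ℕ} [NeZero p] {ψ : ZMod p → ℝ} {Q : ℕ} {M : ℝ}

lemma wienerLE_indicator_of_exp {θ : ZMod p → ℝ} {K : ℝ} (hQ : 0 < Q)
    (hθ : ∀ x, ∃ m : ℤ, θ x = 2 * π / Q * m)
    (h : ∀ n ∈ range Q, WienerLE (fun x => exp (I * n * θ x)) K)
    [∀ x, Decidable (∃ k : ℤ, θ x = 2 * π * k)] :
    WienerLE (fun x => if ∃ k : ℤ, θ x = 2 * π * k then 1 else 0) K := by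
  have := WienerLE.average (nonempty_range_iff.2 hQ.ne') h
  convert this using 2 with x
  obtain ⟨m, hm⟩ := hθ x
  exact (average_exp_eq_ite hQ hm).symm

lemma norm_exp_I_mul_nat_mul (n : ℕ) (t : ℝ) : ‖exp (I * n * t)‖ ≤ 1 := by
  rw [show I * n * t = ((n * t : ℝ) : ℂ) * I by push_cast; ring, Complex.norm_exp_ofReal_mul_I]

lemma wienerLE_exp_slice_fst {n : ℕ} (h : WienerLE (fun x => exp (I * n * ψ x)) M) (y z : ZMod p) :
    WienerLE (fun x => exp (I * n * ((ψ x + ψ (z - x) - ψ y - ψ (z - y) : ℝ) : ℂ))) (M ^ 2) := by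
  have := (h.mul (h.comp_sub_left z)).const_mul
    (norm_exp_I_mul_nat_mul n (-ψ y - ψ (z - y)))
  rw [← sq] at this
  convert this using 2 with x
  rw [← Complex.exp_add, ← Complex.exp_add]
  push_cast
  ring_nf

lemma wienerLE_exp_slice_trd {n : ℕ} (h : WienerLE (fun x => exp (I * n * ψ x)) M) (x y : ZMod p) :
    WienerLE (fun z => exp (I * n * ((ψ x + ψ (z - x) - ψ y - ψ (z - y) : ℝ) : ℂ))) (M ^ 2) := by
  have := ((h.comp_sub_right x).mul (h.conj.comp_sub_right y)).const_mul
    (norm_exp_I_mul_nat_mul n (ψ x - ψ y))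
  rw [← sq] at this
  convert this using 2 with z
  rw [← Complex.exp_conj, ← Complex.exp_add, ← Complex.exp_add]
  simp only [map_mul, Complex.conj_I, Complex.conj_ofReal, map_natCast]
  push_cast
  ring_nf

end Slices

end LevelSet

theorem level_set_measure_dichotomy :
    ∃ c : ℝ, 0 < c ∧ ∃ N₀ : ℕ, ∀ (N : ℕ) [NeZero N], N.Prime → N₀ ≤ N →
      ∀ Q : ℤ, 1 ≤ Q → ∀ M : ℝ, 1 ≤ M →
      ∀ ψ : ZMod N → ℝ, (∀ j : ZMod N, ∃ m : ℤ, ψ j = (2 * π / (Q : ℝ)) * m) →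
      (∀ n : ℤ, 0 ≤ n → n ≤ Q - 1 →
        normAN N (fun j : ZMod N => Complex.exp (Complex.I * (n : ℂ) * (ψ j : ℂ))) ≤ M) →
      min
        ((({p : ZMod N × ZMod N × ZMod N | ∃ m : ℤ,
            ψ p.1 + ψ (p.2.2 - p.1) - ψ p.2.1 - ψ (p.2.2 - p.2.1) = 2 * π * m}).ncard : ℝ)
          / (N : ℝ) ^ 3)
        (1 - (({p : ZMod N × ZMod N × ZMod N | ∃ m : ℤ,
            ψ p.1 + ψ (p.2.2 - p.1) - ψ p.2.1 - ψ (p.2.2 - p.2.1) = 2 * π * m}).ncard : ℝ)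
          / (N : ℝ) ^ 3) ≤
        c * (Real.log (Real.log N) / Real.log N) ^ ((1 : ℝ) / 3) * M ^ 2 := by
  classical
  obtain ⟨N₁, hN₁⟩ := LevelSet.exists_min_density_le
  refine ⟨200, by norm_num, max N₁ 3, fun N _ hN hN₀ Q hQ M hM ψ hψ hψM => ?_⟩
  lift Q to ℕ using by lia
  have hQ0 : 0 < Q := by lia
  have hM2 : 1 ≤ M ^ 2 := one_le_pow₀ hM
  have hexp : ∀ n ∈ Finset.range Q, LevelSet.WienerLE (fun x => exp (I * n * ψ x)) M := by
    intro n hn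
    have := hψM n (by lia) (by have := Finset.mem_range.1 hn; lia)
    exact LevelSet.wienerLE_of_normAN_le (by simpa using this)
  have hval : ∀ x y z : ZMod N, ∃ m : ℤ,
      ψ x + ψ (z - x) - ψ y - ψ (z - y) = 2 * π / Q * m := by
    intro x y z
    obtain ⟨a, ha⟩ := hψ x
    obtain ⟨b, hb⟩ := hψ (z - x)
    obtain ⟨c, hc⟩ := hψ y
    obtain ⟨d, hd⟩ := hψ (z - y)
    refine ⟨a + b - c - d, ?_⟩
    rw [ha, hb, hc, hd]
    push_cast
    ring
  have hlog : 1 ≤ Real.log N := by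
    rw [Real.le_log_iff_exp_le (by exact_mod_cast hN.pos)]
    have h3 : (3 : ℝ) ≤ N := by exact_mod_cast (le_max_right _ _).trans hN₀
    linarith [Real.exp_one_lt_d9]
  have hX : 0 ≤ (Real.log (Real.log N) / Real.log N) ^ ((1 : ℝ) / 3) :=
    Real.rpow_nonneg (div_nonneg (Real.log_nonneg hlog) (by linarith)) _
  have hdens := hN₁ N hN ((le_max_left _ _).trans hN₀)
  have key := LevelSet.min_density_ternary_le
    (E := fun x y z => ∃ m : ℤ, ψ x + ψ (z - x) - ψ y - ψ (z - y) = 2 * π * m)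
    (LevelSet.equivalence_exists_sub_eq ψ)
    (fun y z => by
      rw [ZMod.card]
      exact hdens _ (M ^ 2) hM2 (LevelSet.wienerLE_indicator_of_exp hQ0 (fun x => hval x y z)
        fun n hn => LevelSet.wienerLE_exp_slice_fst (hexp n hn) y z))
    (fun x y => by
      rw [ZMod.card]
      exact hdens _ (M ^ 2) hM2 (LevelSet.wienerLE_indicator_of_exp hQ0 (fun z => hval x y z)
        fun n hn => LevelSet.wienerLE_exp_slice_trd (hexp n hn) x y))
    (by positivity)
  rw [ZMod.card] at key
  rw [Set.ncard_eq_toFinset_card', Set.toFinset_ofPred]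
  convert key using 1
  ring
end

section
/- Let g: ℝ → ℝ be a 2π-periodic Lebesgue measurable function such that for every λ ∈ ℝ the 2π-periodic function e^{iλg} has absolutely summable Fourier coefficients, and sup_{λ∈ℝ} Σ_{k∈ℤ} |(e^{iλg})^∧(k)| < ∞. Then g is constant almost everywhere (with respect to Lebesgue measure). -/
open scoped Real
open Complex MeasureTheory Filter

/-- The `k`-th Fourier coefficient of a `2π`-periodic function `f : ℝ → ℂ`. -/
noncomputable def fourierCoeffT (f : ℝ → ℂ) (k : ℤ) : ℂ :=
  (1 / (2 * (π : ℂ))) * ∫ t in (0 : ℝ)..(2 * π), f t * Complex.exp (-Complex.I * (k : ℂ) * (t : ℂ))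

/-- The `A(𝕋)` norm: the sum of absolute values of the Fourier coefficients. -/
noncomputable def normAT (f : ℝ → ℂ) : ℝ :=
  ∑' k : ℤ, ‖fourierCoeffT f k‖

open AddCircle Topology

theorem integrable_of_norm_le_one {X : Type*} [MeasurableSpace X] {μ : Measure X}
    [IsFiniteMeasure μ] {f : X → ℂ} (hf : Measurable f) (hb : ∀ x, ‖f x‖ ≤ 1) :
    Integrable f μ :=
  .of_bound hf.aestronglyMeasurable 1 (.of_forall hb)

theorem norm_fourier_apply {T : ℝ} (n : ℤ) (x : AddCircle T) : ‖fourier n x‖ = 1 := by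
  rw [fourier_apply, Circle.norm_coe]

theorem measurable_fourier {T : ℝ} (n : ℤ) : Measurable (fourier n : AddCircle T → ℂ) :=
  (fourier n).continuous.measurable

section Circle

variable {T : ℝ} [Fact (0 < T)]

/-- The Fourier coefficients of `f` have `ℓ¹` norm at most `C`. -/
def WienerBound (f : AddCircle T → ℂ) (C : ℝ) : Prop :=
  ∀ s : Finset ℤ, ∑ k ∈ s, ‖fourierCoeff f k‖ ≤ C

namespace WienerBound

variable {f g : AddCircle T → ℂ} {C D : ℝ}

theorem nonneg (h : WienerBound f C) : 0 ≤ C := by simpa using h ∅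

theorem summable (h : WienerBound f C) : Summable fun k => ‖fourierCoeff f k‖ :=
  summable_of_sum_le (fun _ => norm_nonneg _) h

theorem tsum_le (h : WienerBound f C) : ∑' k, ‖fourierCoeff f k‖ ≤ C :=
  h.summable.tsum_le_of_sum_le h

/-- A bounded function with absolutely summable Fourier coefficients is a.e. the sum of its
Fourier series. -/
theorem ae_eq_tsum (h : WienerBound f C) (hf : Measurable f) (hb : ∀ x, ‖f x‖ ≤ 1) :
    f =ᵐ[haarAddCircle] ⇑(∑' k, fourierCoeff f k • fourier k : C(AddCircle T, ℂ)) := by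
  have hs : Summable fun k => fourierCoeff f k • (fourier k : C(AddCircle T, ℂ)) := by
    refine Summable.of_norm ?_
    simpa [norm_smul, fourier_norm] using h.summable
  have hL : MemLp f 2 (haarAddCircle (T := T)) :=
    MemLp.of_bound hf.aestronglyMeasurable 1 (.of_forall hb)
  have h1 := hasSum_fourier_series_L2 (hL.toLp f)
  rw [fourierCoeff_congr_ae hL.coeFn_toLp] at h1
  have h2 := (ContinuousMap.toLp (E := ℂ) 2 (haarAddCircle (T := T)) ℂ).hasSum hs.hasSum
  simp only [map_smul] at h2
  have h3 := h1.unique h2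
  have h4 := ContinuousMap.coeFn_toLp (p := 2) (𝕜 := ℂ) (haarAddCircle (T := T))
    (∑' k, fourierCoeff f k • fourier k : C(AddCircle T, ℂ))
  rw [← h3] at h4
  exact hL.coeFn_toLp.symm.trans h4

theorem of_tendsto {F : ℕ → AddCircle T → ℂ} (h : ∀ n, WienerBound (F n) C)
    (hF : ∀ n, Measurable (F n)) (hb : ∀ n x, ‖F n x‖ ≤ 1)
    (hlim : ∀ x, Tendsto (fun n => F n x) atTop (𝓝 (f x))) : WienerBound f C := by
  intro s
  have hk : ∀ k, Tendsto (fun n => fourierCoeff (F n) k) atTop (𝓝 (fourierCoeff f k)) := by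
    intro k
    refine tendsto_integral_of_dominated_convergence (fun _ => 1) (fun n => ?_)
      (integrable_const _) (fun n => .of_forall fun x => ?_) (.of_forall fun x => ?_)
    · exact ((measurable_fourier _).smul (hF n)).aestronglyMeasurable
    · rw [norm_smul, norm_fourier_apply, one_mul]
      exact hb n x
    · exact (hlim x).const_smul _
  exact le_of_tendsto (tendsto_finsetSum s fun k _ => (hk k).norm) (.of_forall fun n => h n s)

theorem conj (h : WienerBound f C) : WienerBound (fun x => starRingEnd ℂ (f x)) C := by
  intro s
  have hk : ∀ k, ‖fourierCoeff (fun x => starRingEnd ℂ (f x)) k‖ = ‖fourierCoeff f (-k)‖ := by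
    intro k
    rw [← RCLike.norm_conj, fourierCoeff, fourierCoeff, ← integral_conj]
    simp
  simp only [hk]
  have := h (s.map (Equiv.neg ℤ).toEmbedding)
  simpa using this

end WienerBound

theorem fourierCoeff_comp_add_right (f : AddCircle T → ℂ) (s : AddCircle T) (k : ℤ) :
    fourierCoeff (fun x => f (x + s)) k = fourier k s * fourierCoeff f k := by
  rw [fourierCoeff, fourierCoeff, ← integral_add_right_eq_self (fun x => fourier (-k) x • f x) s, ← integral_const_mul]
  congr 1
  ext x
  have : fourier k s * fourier (-k) s = 1 := by
    rw [← fourier_add]; simp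
  simp only [fourier_apply, smul_add, toCircle_add, Circle.coe_mul, smul_eq_mul] at this ⊢
  linear_combination (-(toCircle (-k • x) : ℂ) * f (x + s)) * this

namespace WienerBound

variable {f g : AddCircle T → ℂ} {C D : ℝ}

theorem comp_add_right (h : WienerBound f C) (s : AddCircle T) :
    WienerBound (fun x => f (x + s)) C := by
  intro t
  simpa only [fourierCoeff_comp_add_right, norm_mul, norm_fourier_apply, one_mul] using h t

theorem const_mul (h : WienerBound f C) {c : ℂ} (hc : ‖c‖ = 1) :
    WienerBound (fun x => c * f x) C := by
  intro t
  simpa [fourierCoeff.const_mul, hc] using h t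

theorem average {F : ℕ → AddCircle T → ℂ} (h : ∀ n, WienerBound (F n) C)
    (hF : ∀ n, Integrable (F n) haarAddCircle) (N : ℕ) :
    WienerBound (fun x => (N : ℂ)⁻¹ * ∑ n ∈ Finset.range N, F n x) C := by
  intro s
  have hk : ∀ k, fourierCoeff (fun x => (N : ℂ)⁻¹ * ∑ n ∈ Finset.range N, F n x) k =
      (N : ℂ)⁻¹ * ∑ n ∈ Finset.range N, fourierCoeff (F n) k := by
    intro k
    rw [fourierCoeff.const_mul]
    congr 1
    have := fourierCoeff.sum (Finset.range N) F (fun i _ => hF i)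
    rw [show (fun x => ∑ n ∈ Finset.range N, F n x) = ∑ n ∈ Finset.range N, F n by
      ext x; simp, this, Finset.sum_apply]
  simp only [hk, norm_mul, norm_inv, Complex.norm_natCast]
  rw [← Finset.mul_sum]
  have h1 : ∑ k ∈ s, ‖∑ n ∈ Finset.range N, fourierCoeff (F n) k‖ ≤ N * C := by
    calc _ ≤ ∑ k ∈ s, ∑ n ∈ Finset.range N, ‖fourierCoeff (F n) k‖ :=
          Finset.sum_le_sum fun k _ => norm_sum_le _ _
      _ = ∑ n ∈ Finset.range N, ∑ k ∈ s, ‖fourierCoeff (F n) k‖ := Finset.sum_comm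
      _ ≤ ∑ n ∈ Finset.range N, C := Finset.sum_le_sum fun n _ => h n s
      _ = N * C := by simp
  rcases N.eq_zero_or_pos with rfl | hN
  · simpa using (h 0).nonneg
  · have : (0 : ℝ) < N := by exact_mod_cast hN
    rw [inv_mul_le_iff₀ this]
    exact h1

theorem mul (hf : WienerBound f C) (hg : WienerBound g D) (hfm : Measurable f)
    (hgm : Measurable g) (hfb : ∀ x, ‖f x‖ ≤ 1) (hgb : ∀ x, ‖g x‖ ≤ 1) :
    WienerBound (fun x => f x * g x) (C * D) := by
  intro s
  have hs : Summable fun k => fourierCoeff f k • (fourier k : C(AddCircle T, ℂ)) := by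
    refine Summable.of_norm ?_
    simpa [norm_smul, fourier_norm] using hf.summable
  have hconv : ∀ m, HasSum (fun k => fourierCoeff f k * fourierCoeff g (m - k))
      (fourierCoeff (fun x => f x * g x) m) := by
    intro m
    have hint : ∀ k, Integrable
        (fun x => fourierCoeff f k * (fourier (-(m - k)) x * g x)) haarAddCircle := by
      intro k
      refine (integrable_of_norm_le_one ((measurable_fourier _).mul hgm) fun x => ?_).const_mul _
      rw [Pi.mul_apply, norm_mul, norm_fourier_apply, one_mul]
      exact hgb x
    have key := hasSum_integral_of_summable_integral_norm hint ?_
    · simp only [integral_const_mul] at key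
      convert! key using 1
      refine integral_congr_ae ?_
      filter_upwards [hf.ae_eq_tsum hfm hfb] with x hx
      have h1 : HasSum (fun k => fourierCoeff f k * fourier k x) (f x) := by
        rw [hx]
        exact hs.hasSum.map (ContinuousMap.evalCLM ℂ x) (ContinuousMap.evalCLM ℂ x).continuous
      have h2 := (h1.mul_right (fourier (-m) x * g x)).tsum_eq
      rw [smul_eq_mul, show fourier (-m) x * (f x * g x) = f x * (fourier (-m) x * g x) by ring,
        ← h2]
      congr 1
      ext k
      rw [show -(m - k) = k + -m by ring, fourier_add]
      ring
    · refine Summable.of_nonneg_of_le (fun k => integral_nonneg fun x => norm_nonneg _)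
        (fun k => ?_) hf.summable
      calc _ ≤ ∫ x : AddCircle T, ‖fourierCoeff f k‖ ∂haarAddCircle := by
            refine integral_mono (hint k).norm (integrable_const _) fun x => ?_
            simp only [norm_mul, norm_fourier_apply, one_mul]
            exact mul_le_of_le_one_right (norm_nonneg _) (hgb x)
        _ = _ := by simp
  have hnorm : ∀ m, Summable fun k => ‖fourierCoeff f k‖ * ‖fourierCoeff g (m - k)‖ := by
    intro m
    refine Summable.of_nonneg_of_le (fun k => by positivity) (fun k => ?_)
      (hf.summable.mul_right D)
    gcongr
    simpa using hg {m - k}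
  calc ∑ m ∈ s, ‖fourierCoeff (fun x => f x * g x) m‖
      ≤ ∑ m ∈ s, ∑' k, ‖fourierCoeff f k‖ * ‖fourierCoeff g (m - k)‖ := by
        refine Finset.sum_le_sum fun m _ => ?_
        rw [← (hconv m).tsum_eq]
        simpa only [norm_mul] using norm_tsum_le_tsum_norm
          (f := fun k => fourierCoeff f k * fourierCoeff g (m - k))
          (by simpa only [norm_mul] using hnorm m)
    _ = ∑' k, ∑ m ∈ s, ‖fourierCoeff f k‖ * ‖fourierCoeff g (m - k)‖ :=
        (Summable.tsum_finsetSum fun m _ => hnorm m).symm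
    _ ≤ ∑' k, ‖fourierCoeff f k‖ * D := by
        refine (summable_sum fun m _ => hnorm m).tsum_le_tsum (fun k => ?_)
          (hf.summable.mul_right D)
        rw [← Finset.mul_sum]
        gcongr
        simpa using hg (s.map (Equiv.subRight k).toEmbedding)
    _ ≤ C * D := by
        rw [tsum_mul_right]
        exact mul_le_mul_of_nonneg_right hf.tsum_le hg.nonneg

end WienerBound

theorem norm_cesaro_pow_le {z : ℂ} (hz : ‖z‖ = 1) (N : ℕ) :
    ‖(N : ℂ)⁻¹ * ∑ n ∈ Finset.range N, z ^ n‖ ≤ 1 := by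
  rcases N.eq_zero_or_pos with rfl | hN
  · simp
  have hN' : (0 : ℝ) < N := by exact_mod_cast hN
  rw [norm_mul, norm_inv, Complex.norm_natCast, inv_mul_le_iff₀ hN', mul_one]
  simpa [hz] using norm_sum_le (Finset.range N) fun n => z ^ n

theorem tendsto_cesaro_pow {z : ℂ} (hz : ‖z‖ = 1) :
    Tendsto (fun N : ℕ => (N : ℂ)⁻¹ * ∑ n ∈ Finset.range N, z ^ n) atTop
      (𝓝 (if z = 1 then 1 else 0)) := by
  split_ifs with h
  · subst h
    refine tendsto_const_nhds.congr' ?_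
    filter_upwards [eventually_ne_atTop 0] with N hN
    simp [hN]
  · have hz1 : 0 < ‖z - 1‖ := norm_pos_iff.2 (sub_ne_zero.2 h)
    refine squeeze_zero_norm (a := fun N : ℕ => (N : ℝ)⁻¹ * (2 / ‖z - 1‖)) (fun N => ?_) ?_
    · rw [geom_sum_eq h, norm_mul, norm_inv, Complex.norm_natCast, norm_div]
      gcongr
      refine (norm_sub_le _ _).trans ?_
      simp [hz]
      norm_num
    · simpa using (tendsto_inv_atTop_nhds_zero_nat (𝕜 := ℝ)).mul_const (2 / ‖z - 1‖)

theorem mul_conj_eq_one_iff {a b : ℂ} (hb : ‖b‖ = 1) : a * starRingEnd ℂ b = 1 ↔ a = b := by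
  have h : b * starRingEnd ℂ b = 1 := by
    rw [Complex.mul_conj, Complex.normSq_eq_norm_sq, hb]; norm_num
  constructor
  · intro h1
    linear_combination b * h1 - a * h
  · rintro rfl
    exact h

/-- If `v` is unimodular and its powers are bounded in the Wiener algebra, then its level sets are
null or conull: the indicator of a level set is a bounded limit of averages of the powers of `v`,
hence agrees a.e. with a continuous function. -/
theorem ae_eq_const_of_measure_ne_zero {v : AddCircle T → ℂ} {C : ℝ} (hv : Measurable v)
    (hv1 : ∀ x, ‖v x‖ = 1) (hb : ∀ n : ℕ, WienerBound (fun x => v x ^ n) C) {z : ℂ}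
    (hz : haarAddCircle {x | v x = z} ≠ 0) : ∀ᵐ x ∂haarAddCircle, v x = z := by
  have hz1 : ‖z‖ = 1 := by
    by_contra hne
    refine hz ?_
    rw [show {x | v x = z} = ∅ from Set.eq_empty_of_forall_notMem ?_, measure_empty]
    rintro x rfl
    exact hne (hv1 x)
  have hw1 : ∀ x, ‖v x * starRingEnd ℂ z‖ = 1 := fun x => by
    rw [norm_mul, RCLike.norm_conj, hv1, hz1, one_mul]
  have hwm : Measurable fun x => v x * starRingEnd ℂ z := hv.mul_const _
  classical
  set f : AddCircle T → ℂ := fun x => if v x * starRingEnd ℂ z = 1 then 1 else 0 with hf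
  have hfm : Measurable f :=
    Measurable.ite (hwm (measurableSet_singleton 1)) measurable_const measurable_const
  have hf1 : ∀ x, ‖f x‖ ≤ 1 := fun x => by
    simp only [hf]; split_ifs <;> simp
  have hfW : WienerBound f C := by
    refine WienerBound.of_tendsto
      (F := fun N x => (N : ℂ)⁻¹ * ∑ n ∈ Finset.range N, (v x * starRingEnd ℂ z) ^ n)
      (fun N => ?_) (fun N => ?_) (fun N x => norm_cesaro_pow_le (hw1 x) N)
      (fun x => tendsto_cesaro_pow (hw1 x))
    · refine WienerBound.average (F := fun n x => (v x * starRingEnd ℂ z) ^ n) (fun n => ?_)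
        (fun n => ?_) N
      · have := (hb n).const_mul (c := starRingEnd ℂ z ^ n) (by simp [hz1])
        simpa only [mul_pow, mul_comm] using this
      · exact integrable_of_norm_le_one (hwm.pow_const n) fun x => by simp [hv1, hz1]
    · exact (Finset.measurable_fun_sum _ fun n _ => hwm.pow_const n).const_mul _
  have hae := hfW.ae_eq_tsum hfm hf1
  set F : C(AddCircle T, ℂ) := ∑' k, fourierCoeff f k • fourier k
  have hFF : ∀ x, F x * F x = F x := by
    refine congrFun ((Continuous.ae_eq_iff_eq (haarAddCircle (T := T))
      (F.continuous.mul F.continuous) F.continuous).1 ?_)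
    filter_upwards [hae] with x hx
    simp only [Pi.mul_apply, ← hx, hf]
    split_ifs <;> simp
  have h01 : ∀ x, F x = 0 ∨ F x = 1 := fun x => by
    rcases eq_or_ne (F x) 0 with h | h
    · exact .inl h
    · exact .inr (mul_left_cancel₀ h (by rw [hFF, mul_one]))
  have hclopen : IsClopen {x | F x = 1} := by
    refine ⟨isClosed_eq F.continuous continuous_const, isClosed_compl_iff.1 ?_⟩
    have : {x | F x = 1}ᶜ = {x | F x = 0} := by
      ext x
      rcases h01 x with h | h <;> simp [h]
    rw [this]
    exact isClosed_eq F.continuous continuous_const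
  rcases isClopen_iff.1 hclopen with h | h
  · refine absurd ?_ hz
    refine measure_mono_null (fun x hx => ?_) (ae_iff.1 hae)
    have h1 : f x = 1 := if_pos ((mul_conj_eq_one_iff hz1).2 hx)
    have h2 : F x ≠ 1 := fun h3 => (h ▸ (show x ∈ {x | F x = 1} from h3) : x ∈ (∅ : Set _))
    simpa [h1] using h2.symm
  · filter_upwards [hae] with x hx
    have h1 : F x = 1 := (h ▸ Set.mem_univ x : x ∈ {x | F x = 1})
    rw [h1] at hx
    by_contra hne
    simp [hf, mul_conj_eq_one_iff hz1, hne] at hx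

/-- A form of Wiener's lemma: if the law of a unimodular function has no atoms, its moments tend to
zero in quadratic mean. -/
theorem tendsto_cesaro_norm_integral_pow_sq {X : Type*} [MeasurableSpace X] {μ : Measure X}
    [IsProbabilityMeasure μ] {v : X → ℂ} (hv : Measurable v) (hv1 : ∀ x, ‖v x‖ = 1)
    (h0 : ∀ z, μ {x | v x = z} = 0) :
    Tendsto (fun N : ℕ => (N : ℝ)⁻¹ * ∑ n ∈ Finset.range N, ‖∫ x, v x ^ n ∂μ‖ ^ 2) atTop
      (𝓝 0) := by
  set ψ : X × X → ℂ := fun p => v p.1 * starRingEnd ℂ (v p.2) with hψ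
  have hψm : Measurable ψ :=
    (hv.comp measurable_fst).mul (Complex.continuous_conj.measurable.comp (hv.comp measurable_snd))
  have hψ1 : ∀ p, ‖ψ p‖ = 1 := fun p => by simp [hψ, hv1]
  have hψn : ∀ᵐ p ∂μ.prod μ, ψ p ≠ 1 := by
    have hms : MeasurableSet {p | ψ p = 1} := hψm (measurableSet_singleton 1)
    rw [ae_iff]
    simp only [not_not]
    rw [Measure.measure_prod_null hms]
    refine .of_forall fun x => ?_
    refine measure_mono_null (fun y hy => ?_) (h0 (v x))
    exact ((mul_conj_eq_one_iff (hv1 y)).1 hy).symm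
  have hint : ∀ n : ℕ, ∫ p, ψ p ^ n ∂μ.prod μ = ((‖∫ x, v x ^ n ∂μ‖ ^ 2 : ℝ) : ℂ) := by
    intro n
    simp only [hψ, mul_pow]
    rw [integral_prod_mul (fun x => v x ^ n) (fun y => starRingEnd ℂ (v y) ^ n)]
    simp only [← map_pow]
    rw [integral_conj, Complex.mul_conj, Complex.normSq_eq_norm_sq]
  have hlim : Tendsto (fun N : ℕ => ∫ p, (N : ℂ)⁻¹ * ∑ n ∈ Finset.range N, ψ p ^ n ∂μ.prod μ)
      atTop (𝓝 (∫ p : X × X, (0 : ℂ) ∂μ.prod μ)) := by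
    refine tendsto_integral_of_dominated_convergence (fun _ => 1) (fun N => ?_)
      (integrable_const _) (fun N => .of_forall fun p => norm_cesaro_pow_le (hψ1 p) N) ?_
    · exact ((Finset.measurable_fun_sum _ fun n _ =>
        hψm.pow_const n).const_mul _).aestronglyMeasurable
    · filter_upwards [hψn] with p hp
      simpa [hp] using tendsto_cesaro_pow (hψ1 p)
  have hre := (Complex.continuous_re.tendsto _).comp hlim
  simp only [integral_zero, Complex.zero_re] at hre
  refine hre.congr fun N => ?_
  have : ∫ p, (N : ℂ)⁻¹ * ∑ n ∈ Finset.range N, ψ p ^ n ∂μ.prod μ =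
      (((N : ℝ)⁻¹ * ∑ n ∈ Finset.range N, ‖∫ x, v x ^ n ∂μ‖ ^ 2 : ℝ) : ℂ) := by
    rw [integral_const_mul, integral_finsetSum _ fun n _ =>
      integrable_of_norm_le_one (hψm.pow_const n) fun p => by simp [hψ1]]
    simp [hint]
  rw [Function.comp_apply, this, Complex.ofReal_re]

theorem exists_le_norm_fourierCoeff {w : AddCircle T → ℂ} {C : ℝ} (hw : Measurable w)
    (hw1 : ∀ x, ‖w x‖ = 1) (h : WienerBound w C) : ∃ k, (C + 1)⁻¹ ≤ ‖fourierCoeff w k‖ := by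
  by_contra! hlt
  have hC := h.nonneg
  have hL : MemLp w 2 (haarAddCircle (T := T)) :=
    MemLp.of_bound hw.aestronglyMeasurable 1 (.of_forall fun x => (hw1 x).le)
  have h1 := hasSum_sq_fourierCoeff (hL.toLp w)
  rw [fourierCoeff_congr_ae hL.coeFn_toLp] at h1
  have h2 : ∫ t, ‖(hL.toLp w : AddCircle T → ℂ) t‖ ^ 2 ∂haarAddCircle = 1 := by
    rw [integral_congr_ae (g := fun _ => (1 : ℝ))]
    · simp
    · filter_upwards [hL.coeFn_toLp] with x hx
      rw [hx, hw1, one_pow]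
  rw [h2] at h1
  have h3 : (1 : ℝ) ≤ (C + 1)⁻¹ * C := by
    refine h1.tsum_eq.ge.trans ?_
    refine (h1.summable.tsum_le_tsum (fun k => ?_) (h.summable.mul_left (C + 1)⁻¹)).trans ?_
    · rw [sq]
      exact mul_le_mul_of_nonneg_right (hlt k).le (norm_nonneg _)
    · rw [tsum_mul_left]
      exact mul_le_mul_of_nonneg_left h.tsum_le (by positivity)
  rw [le_inv_mul_iff₀ (by positivity)] at h3
  linarith

/-- The autocorrelation function of `w`. -/
noncomputable def autocorrelation (w : AddCircle T → ℂ) (s : AddCircle T) : ℂ :=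
  ∫ x, w (x + s) * starRingEnd ℂ (w x) ∂haarAddCircle

/-- The `k`-th Fourier coefficient of the autocorrelation of `w` is `‖fourierCoeff w k‖ ^ 2`. -/
theorem fourierCoeff_autocorrelation {w : AddCircle T → ℂ} (hw : Measurable w)
    (hw1 : ∀ x, ‖w x‖ ≤ 1) (k : ℤ) :
    fourierCoeff (autocorrelation w) k =
      ((‖fourierCoeff w k‖ ^ 2 : ℝ) : ℂ) := by
  have hm : Measurable fun p : AddCircle T × AddCircle T =>
      fourier (-k) p.1 * (w (p.2 + p.1) * starRingEnd ℂ (w p.2)) :=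
    ((measurable_fourier _).comp measurable_fst).mul
      ((hw.comp (measurable_snd.add measurable_fst)).mul
        (Complex.continuous_conj.measurable.comp (hw.comp measurable_snd)))
  have hint : Integrable (Function.uncurry fun s x : AddCircle T =>
      fourier (-k) s * (w (x + s) * starRingEnd ℂ (w x)))
      (haarAddCircle.prod haarAddCircle) := by
    refine integrable_of_norm_le_one hm fun p => ?_
    simp only [Function.uncurry, norm_mul, norm_fourier_apply, one_mul, RCLike.norm_conj]
    exact mul_le_one₀ (hw1 _) (norm_nonneg _) (hw1 _)
  rw [fourierCoeff]
  simp only [autocorrelation, smul_eq_mul, ← integral_const_mul]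
  rw [integral_integral_swap hint]
  have hinner : ∀ x : AddCircle T,
      ∫ s, fourier (-k) s * (w (x + s) * starRingEnd ℂ (w x)) ∂haarAddCircle =
        starRingEnd ℂ (fourier (-k) x * w x) * fourierCoeff w k := by
    intro x
    have h1 := fourierCoeff_comp_add_right w x k
    rw [fourierCoeff] at h1
    simp only [smul_eq_mul] at h1
    calc _ = ∫ s, fourier (-k) s * w (s + x) * starRingEnd ℂ (w x) ∂haarAddCircle := by
          simp only [add_comm x, mul_assoc]
      _ = _ := by
          rw [integral_mul_const, h1, map_mul, ← fourier_neg, neg_neg]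
          ring
  simp only [hinner]
  rw [integral_mul_const, integral_conj]
  rw [show ∫ x, fourier (-k) x * w x ∂haarAddCircle = fourierCoeff w k from rfl, mul_comm,
    Complex.mul_conj, Complex.normSq_eq_norm_sq]

theorem measurable_autocorrelation {w : AddCircle T → ℂ} (hw : Measurable w) :
    Measurable (autocorrelation w) := by
  have hm : Measurable fun p : AddCircle T × AddCircle T =>
      w (p.2 + p.1) * starRingEnd ℂ (w p.2) :=
    (hw.comp (measurable_snd.add measurable_fst)).mul
      (Complex.continuous_conj.measurable.comp (hw.comp measurable_snd))
  exact hm.stronglyMeasurable.integral_prod_right.measurable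

theorem norm_autocorrelation_le {w : AddCircle T → ℂ} (hw1 : ∀ x, ‖w x‖ = 1) (s : AddCircle T) :
    ‖autocorrelation w s‖ ≤ 1 := by
  simpa [autocorrelation] using norm_integral_le_of_norm_le_const (μ := haarAddCircle (T := T)) (C := 1)
    (f := fun x => w (x + s) * starRingEnd ℂ (w x)) (.of_forall fun x => by simp [hw1])

theorem le_integral_norm_autocorrelation_sq {w : AddCircle T → ℂ} {C : ℝ} (hw : Measurable w)
    (hw1 : ∀ x, ‖w x‖ = 1) (h : WienerBound w C) :
    ((C + 1)⁻¹ ^ 2) ^ 2 ≤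
      ∫ s, ‖autocorrelation w s‖ ^ 2 ∂haarAddCircle := by
  obtain ⟨k, hk⟩ := exists_le_norm_fourierCoeff hw hw1 h
  have hC := h.nonneg
  set D := autocorrelation w
  have hDm : Measurable D := measurable_autocorrelation hw
  have hD1 : ∀ s, ‖D s‖ ≤ 1 := norm_autocorrelation_le hw1
  set δ : ℝ := (C + 1)⁻¹ ^ 2 with hδ
  have hδ0 : 0 < δ := by positivity
  have hDi : Integrable (fun s => ‖D s‖ ^ 2) (haarAddCircle (T := T)) :=
    .of_bound (hDm.norm.pow_const 2).aestronglyMeasurable 1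
      (.of_forall fun s => by simpa using hD1 s)
  have h1 : δ ≤ ∫ s, ‖D s‖ ∂haarAddCircle := by
    calc δ ≤ ‖fourierCoeff w k‖ ^ 2 := pow_le_pow_left₀ (by positivity) hk 2
      _ = ‖fourierCoeff D k‖ := by
        rw [fourierCoeff_autocorrelation hw (fun x => (hw1 x).le), Complex.norm_real,
          Real.norm_of_nonneg (by positivity)]
      _ ≤ ∫ s, ‖fourier (-k) s • D s‖ ∂haarAddCircle := norm_integral_le_integral_norm _
      _ = _ := by simp only [norm_smul, norm_fourier_apply, one_mul]
  have h2 : ∫ s, 2 * δ * ‖D s‖ ∂haarAddCircle ≤ ∫ s, (δ ^ 2 + ‖D s‖ ^ 2) ∂haarAddCircle := by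
    refine integral_mono ((integrable_of_norm_le_one hDm hD1).norm.const_mul _)
      ((integrable_const _).add hDi) fun s => ?_
    dsimp only
    nlinarith [sq_nonneg (δ - ‖D s‖)]
  rw [integral_const_mul, integral_add (integrable_const _) hDi] at h2
  simp only [integral_const, probReal_univ, one_smul] at h2
  nlinarith

theorem ae_zsmul_ne_zero : ∀ᵐ s : AddCircle T ∂haarAddCircle, ∀ n : ℤ, n ≠ 0 → n • s ≠ 0 := by
  rw [ae_all_iff]
  intro n
  by_cases hn : n = 0
  · simp [hn]
  rw [ae_iff]
  have hfin : {u : AddCircle T | n.natAbs • u = 0}.Finite :=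
    finite_torsion T (Int.natAbs_pos.2 hn)
  have : Infinite (AddCircle T) := (equivIoc T 0).infinite_iff.2
    (Set.Ioc_infinite (lt_add_of_pos_right 0 (Fact.out : 0 < T))).to_subtype
  refine measure_mono_null (fun s hs => ?_) (hfin.measure_zero _)
  simp only [not_forall, not_not, Set.mem_ofPred_eq] at hs
  obtain ⟨-, hs⟩ := hs
  rcases Int.natAbs_eq n with h | h <;> rw [h] at hs <;> simpa using hs

/-- If the quadratic means of a uniformly bounded sequence of functions tend to zero a.e., then the
`L²` norms of the functions are not bounded away from zero. -/
theorem exists_integral_norm_sq_lt {X : Type*} [MeasurableSpace X] {μ : Measure X}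
    [IsProbabilityMeasure μ] {D : ℕ → X → ℂ} (hD : ∀ n, Measurable (D n))
    (hD1 : ∀ n x, ‖D n x‖ ≤ 1)
    (hlim : ∀ᵐ x ∂μ, Tendsto (fun N : ℕ => (N : ℝ)⁻¹ * ∑ n ∈ Finset.range N, ‖D n x‖ ^ 2) atTop
      (𝓝 0)) {δ : ℝ} (hδ : 0 < δ) : ∃ n, ∫ x, ‖D n x‖ ^ 2 ∂μ < δ := by
  by_contra! hlow
  have hsq : ∀ n x, ‖D n x‖ ^ 2 ≤ 1 := fun n x => pow_le_one₀ (norm_nonneg _) (hD1 n x)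
  have hmain : Tendsto (fun N : ℕ => ∫ x, (N : ℝ)⁻¹ * ∑ n ∈ Finset.range N, ‖D n x‖ ^ 2 ∂μ) atTop
      (𝓝 (∫ x : X, (0 : ℝ) ∂μ)) := by
    refine tendsto_integral_of_dominated_convergence (fun _ => 1) (fun N => ?_)
      (integrable_const _) (fun N => .of_forall fun x => ?_) hlim
    · exact ((Finset.measurable_fun_sum _ fun n _ =>
        (hD n).norm.pow_const 2).const_mul _).aestronglyMeasurable
    · rw [Real.norm_of_nonneg (by positivity)]
      rcases N.eq_zero_or_pos with rfl | hN
      · simp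
      have hN' : (0 : ℝ) < N := by exact_mod_cast hN
      rw [inv_mul_le_iff₀ hN', mul_one]
      simpa only [Finset.card_range, nsmul_eq_mul, mul_one] using
        Finset.sum_le_card_nsmul (Finset.range N) (fun n => ‖D n x‖ ^ 2) 1 fun n _ => hsq n x
  rw [integral_zero] at hmain
  have hge : ∀ᶠ N : ℕ in atTop,
      δ ≤ ∫ x, (N : ℝ)⁻¹ * ∑ n ∈ Finset.range N, ‖D n x‖ ^ 2 ∂μ := by
    filter_upwards [eventually_gt_atTop 0] with N hN
    have hN' : (0 : ℝ) < N := by exact_mod_cast hN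
    have hint : ∀ n ∈ Finset.range N, Integrable (fun x => ‖D n x‖ ^ 2) μ := fun n _ =>
      .of_bound ((hD n).norm.pow_const 2).aestronglyMeasurable 1
        (.of_forall fun x => by simpa using hD1 n x)
    rw [integral_const_mul, integral_finsetSum _ hint, le_inv_mul_iff₀ hN']
    simpa only [Finset.card_range, nsmul_eq_mul] using Finset.card_nsmul_le_sum (Finset.range N)
      (fun n => ∫ x, ‖D n x‖ ^ 2 ∂μ) δ fun n _ => hlow n
  exact hδ.not_ge (ge_of_tendsto hmain hge)

theorem exists_shift {u : AddCircle T → ℂ} {C : ℝ} (hu : Measurable u) (hu1 : ∀ x, ‖u x‖ = 1)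
    (hb : ∀ n : ℕ, WienerBound (fun x => u x ^ n) C) :
    ∃ s : AddCircle T, (∀ n : ℤ, n ≠ 0 → n • s ≠ 0) ∧
      ∃ z, haarAddCircle {x | u (x + s) * starRingEnd ℂ (u x) = z} ≠ 0 := by
  by_contra! hcon
  have hC := (hb 0).nonneg
  have hpm : ∀ n : ℕ, Measurable fun x => u x ^ n := fun n => hu.pow_const n
  have hp1 : ∀ (n : ℕ) x, ‖u x ^ n‖ = 1 := fun n x => by simp [hu1]
  have hlim : ∀ᵐ s : AddCircle T ∂haarAddCircle, Tendsto (fun N : ℕ => (N : ℝ)⁻¹ *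
      ∑ n ∈ Finset.range N, ‖autocorrelation (fun x => u x ^ n) s‖ ^ 2)
      atTop (𝓝 0) := by
    filter_upwards [ae_zsmul_ne_zero] with s hs
    have hvm : Measurable fun x => u (x + s) * starRingEnd ℂ (u x) :=
      (hu.comp (measurable_id.add_const s)).mul (Complex.continuous_conj.measurable.comp hu)
    simpa only [autocorrelation, map_pow, mul_pow] using
      tendsto_cesaro_norm_integral_pow_sq hvm (fun x => by simp [hu1]) (hcon s hs)
  have hδ : 0 < ((C + 1)⁻¹ ^ 2) ^ 2 := by positivity
  obtain ⟨n, hn⟩ := exists_integral_norm_sq_lt (fun n => measurable_autocorrelation (hpm n))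
    (fun n => norm_autocorrelation_le (hp1 n)) hlim hδ
  exact hn.not_ge (le_integral_norm_autocorrelation_sq (hpm n) (hp1 n) (hb n))

/-- A form of the Beurling–Helson theorem: a unimodular function with power-bounded norm in the
Wiener algebra and nonzero mean is a.e. constant. -/
theorem ae_eq_const_of_powers_bounded {u : AddCircle T → ℂ} {C : ℝ} (hu : Measurable u)
    (hu1 : ∀ x, ‖u x‖ = 1) (hb : ∀ n : ℕ, WienerBound (fun x => u x ^ n) C)
    (h0 : fourierCoeff u 0 ≠ 0) : ∀ᵐ x ∂haarAddCircle, u x = fourierCoeff u 0 := by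
  obtain ⟨s, hs, z, hz⟩ := exists_shift hu hu1 hb
  have hvm : Measurable fun x => u (x + s) * starRingEnd ℂ (u x) :=
    (hu.comp (measurable_id.add_const s)).mul (Complex.continuous_conj.measurable.comp hu)
  have hconst := ae_eq_const_of_measure_ne_zero (C := C * C) hvm (fun x => by simp [hu1])
    (fun n => by
      simp only [mul_pow, ← map_pow]
      exact ((hb n).comp_add_right s).mul (hb n).conj ((hu.pow_const n).comp
        (measurable_id.add_const s)) (Complex.continuous_conj.measurable.comp (hu.pow_const n))
        (fun x => by simp [hu1]) (fun x => by simp [hu1])) hz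
  have hshift : (fun x => u (x + s)) =ᵐ[haarAddCircle] fun x => z * u x := by
    filter_upwards [hconst] with x hx
    have := (mul_conj_eq_one_iff (hu1 x)).2 rfl
    linear_combination u x * hx - u (x + s) * this
  have hcoeff : ∀ k, fourier k s * fourierCoeff u k = z * fourierCoeff u k := fun k => by
    rw [← fourierCoeff_comp_add_right, fourierCoeff_congr_ae hshift, fourierCoeff.const_mul]
  have hz1 : z = 1 := by
    have := mul_right_cancel₀ h0 (hcoeff 0)
    rw [← this, fourier_zero]
  have hzero : ∀ k, k ≠ 0 → fourierCoeff u k = 0 := by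
    intro k hk
    by_contra hne
    have h1 := mul_right_cancel₀ hne (hcoeff k)
    rw [hz1, fourier_apply, Circle.coe_eq_one, ← toCircle_zero (T := T)] at h1
    exact hs k hk (injective_toCircle (Fact.out : 0 < T).ne' h1)
  have hW : WienerBound u C := by simpa using hb 1
  have hae := hW.ae_eq_tsum hu fun x => (hu1 x).le
  rw [tsum_eq_single 0 fun k hk => by rw [hzero k hk, zero_smul]] at hae
  filter_upwards [hae] with x hx
  rw [hx]
  simp

/-- If `exp (i g / n)` is a.e. constant for all large `n`, then so is `g`. -/
theorem ae_eq_const_of_ae_exp_eq_const {X : Type*} [MeasurableSpace X] {μ : Measure X} [NeZero μ]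
    {G : X → ℝ} (h : ∀ᶠ m : ℕ in atTop, ∃ c : ℂ, ∀ᵐ x ∂μ,
      Complex.exp (Complex.I * (((m : ℝ)⁻¹ : ℝ) : ℂ) * (G x : ℂ)) = c) :
    ∃ c : ℝ, ∀ᵐ x ∂μ, G x = c := by
  obtain ⟨M, hM⟩ := eventually_atTop.1 h
  choose! c hc using hM
  have hall : ∀ᵐ x ∂μ, ∀ m, M ≤ m →
      Complex.exp (Complex.I * (((m : ℝ)⁻¹ : ℝ) : ℂ) * (G x : ℂ)) = c m := by
    rw [ae_all_iff]
    intro m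
    by_cases hm : M ≤ m
    · filter_upwards [hc m hm] with x hx _ using hx
    · exact .of_forall fun x h => absurd h hm
  obtain ⟨y, hy⟩ := hall.exists
  refine ⟨G y, ?_⟩
  filter_upwards [hall] with x hx
  obtain ⟨m, hm⟩ := exists_nat_gt (max (M : ℝ) |G x - G y|)
  have hmM : M ≤ m := by exact_mod_cast ((le_max_left _ _).trans_lt hm).le
  have hmd : |G x - G y| < m := (le_max_right _ _).trans_lt hm
  have hm0 : (0 : ℝ) < m := (abs_nonneg _).trans_lt hmd
  obtain ⟨k, hk⟩ := Complex.exp_eq_exp_iff_exists_int.1 ((hx m hmM).trans (hy m hmM).symm)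
  have hk' : (m : ℝ)⁻¹ * G x = (m : ℝ)⁻¹ * G y + k * (2 * π) := by
    have h1 : Complex.I * (((m : ℝ)⁻¹ * G x : ℝ) : ℂ) =
        Complex.I * (((m : ℝ)⁻¹ * G y + k * (2 * π) : ℝ) : ℂ) := by
      push_cast at hk ⊢
      linear_combination hk
    exact_mod_cast mul_left_cancel₀ Complex.I_ne_zero h1
  have hd : G x - G y = m * (k * (2 * π)) := by
    field_simp at hk'
    linarith
  rcases eq_or_ne k 0 with rfl | hk0
  · simpa [sub_eq_zero] using hd
  · exfalso
    have h1 : (1 : ℝ) ≤ |(k : ℝ)| := by exact_mod_cast Int.one_le_abs hk0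
    rw [hd, abs_mul, abs_mul, abs_of_pos hm0, abs_of_pos Real.two_pi_pos] at hmd
    have h2 : (1 : ℝ) ≤ |(k : ℝ)| * (2 * π) := by nlinarith [Real.pi_gt_three]
    nlinarith

theorem ae_eq_const_of_wienerBound_exp {G : AddCircle T → ℝ} {C : ℝ} (hG : Measurable G)
    (hb : ∀ lam : ℝ,
      WienerBound (fun x => Complex.exp (Complex.I * (lam : ℂ) * (G x : ℂ))) C) :
    ∃ c : ℝ, ∀ᵐ x ∂haarAddCircle, G x = c := by
  set u : ℝ → AddCircle T → ℂ := fun lam x => Complex.exp (Complex.I * (lam : ℂ) * (G x : ℂ))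
    with hu
  have hum : ∀ lam, Measurable (u lam) := fun lam =>
    Complex.measurable_exp.comp ((Complex.measurable_ofReal.comp hG).const_mul _)
  have hu1 : ∀ lam x, ‖u lam x‖ = 1 := fun lam x => by
    simp only [hu]
    rw [mul_assoc, mul_comm, ← Complex.ofReal_mul, Complex.norm_exp_ofReal_mul_I]
  have hpow : ∀ lam (n : ℕ), (fun x => u lam x ^ n) = u (n * lam) := fun lam n => by
    ext x
    simp only [hu, ← Complex.exp_nat_mul]
    congr 1
    push_cast
    ring
  refine ae_eq_const_of_ae_exp_eq_const ?_
  have hlim : Tendsto (fun m : ℕ => fourierCoeff (u (m : ℝ)⁻¹) 0) atTop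
      (𝓝 (fourierCoeff (fun _ : AddCircle T => (1 : ℂ)) 0)) := by
    refine tendsto_integral_of_dominated_convergence (fun _ => 1) (fun m => ?_)
      (integrable_const _) (fun m => .of_forall fun x => ?_) (.of_forall fun x => ?_)
    · exact ((measurable_fourier _).smul (hum _)).aestronglyMeasurable
    · rw [norm_smul, norm_fourier_apply, one_mul, hu1]
    · refine Tendsto.const_smul ?_ _
      have hc : Continuous fun lam : ℝ => u lam x := by
        simp only [hu]; fun_prop
      have := (hc.tendsto 0).comp (tendsto_inv_atTop_nhds_zero_nat (𝕜 := ℝ))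
      simpa [hu, Function.comp_def] using this
  have h1 : fourierCoeff (fun _ : AddCircle T => (1 : ℂ)) 0 = 1 := by
    simp [fourierCoeff]
  rw [h1] at hlim
  filter_upwards [hlim.eventually_ne one_ne_zero] with m hm
  refine ⟨_, ae_eq_const_of_powers_bounded (C := C) (hum _) (hu1 _) (fun n => ?_) hm⟩
  rw [hpow]
  exact hb _

/-- A property holding a.e. on the circle holds a.e. on the line. -/
theorem ae_coe_of_ae_haarAddCircle {p : AddCircle T → Prop}
    (h : ∀ᵐ x ∂haarAddCircle, p x) : ∀ᵐ t : ℝ, p t := by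
  have hvol : ∀ᵐ x : AddCircle T, p x := by
    rw [volume_eq_smul_haarAddCircle]
    exact Measure.ae_smul_measure h _
  have hcover : (⋃ n : ℤ, Set.Ioc (n • T) (n • T + T)) = Set.univ := by
    simpa [add_smul] using iUnion_Ioc_zsmul (Fact.out : 0 < T)
  rw [← Measure.restrict_univ (μ := (volume : Measure ℝ)), ← hcover, ae_restrict_iUnion_iff]
  exact fun n => (AddCircle.measurePreserving_mk T (n • T)).quasiMeasurePreserving.ae hvol

end Circle

theorem fourierCoeffT_eq_fourierCoeff [Fact (0 < 2 * π)] (f : AddCircle (2 * π) → ℂ) (k : ℤ) :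
    fourierCoeffT (fun t => f t) k = fourierCoeff f k := by
  rw [fourierCoeff_eq_intervalIntegral f k 0, fourierCoeffT, zero_add, Complex.real_smul]
  push_cast
  congr 1
  refine intervalIntegral.integral_congr fun t _ => ?_
  have hpi : (π : ℂ) ≠ 0 := Complex.ofReal_ne_zero.2 Real.pi_ne_zero
  simp only [smul_eq_mul]
  rw [fourier_coe_apply, mul_comm]
  congr 2
  push_cast
  field_simp

theorem constant_of_uniformly_bounded_exponentials
    (g : ℝ → ℝ) (hmeas : Measurable g) (hper : Function.Periodic g (2 * π))
    (hsum : ∀ lam : ℝ, Summable fun k : ℤ =>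
      ‖fourierCoeffT (fun t : ℝ => Complex.exp (Complex.I * (lam : ℂ) * (g t : ℂ))) k‖)
    (C : ℝ)
    (hbound : ∀ lam : ℝ,
      normAT (fun t : ℝ => Complex.exp (Complex.I * (lam : ℂ) * (g t : ℂ))) ≤ C) :
    ∃ c : ℝ, ∀ᵐ t : ℝ, g t = c := by
  have : Fact (0 < 2 * π) := ⟨Real.two_pi_pos⟩
  set G : AddCircle (2 * π) → ℝ := hper.lift with hGdef
  have hGg : ∀ t : ℝ, G t = g t := hper.lift_coe
  have hGm : Measurable G := by
    have h : G = fun x => g (measurableEquivIoc (2 * π) 0 x : ℝ) := by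
      ext x
      rw [← hGg]
      congr 1
      exact ((equivIoc (2 * π) 0).symm_apply_apply x).symm
    rw [h]
    exact hmeas.comp (measurable_subtype_coe.comp (measurableEquivIoc (2 * π) 0).measurable)
  obtain ⟨c, hc⟩ := ae_eq_const_of_wienerBound_exp (C := C) hGm fun lam s => by
    have hcoeff : ∀ k, fourierCoeff
        (fun x => Complex.exp (Complex.I * (lam : ℂ) * (G x : ℂ))) k =
        fourierCoeffT (fun t : ℝ => Complex.exp (Complex.I * (lam : ℂ) * (g t : ℂ))) k :=
      fun k => by simp only [← fourierCoeffT_eq_fourierCoeff, hGg]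
    simp only [hcoeff]
    exact ((hsum lam).sum_le_tsum s fun _ _ => norm_nonneg _).trans (hbound lam)
  exact ⟨c, by simpa only [hGg] using ae_coe_of_ae_haarAddCircle hc⟩
end

section
/- Let φ: ℝ → ℝ be absolutely continuous in the sense that there is a locally integrable function g: ℝ → ℝ with φ(t) = φ(0) + ∫₀ᵗ g(s) ds for all t ∈ ℝ, and suppose φ(t+2π) − φ(t) ∈ 2πℤ for all t (so φ induces a mapping of the circle 𝕋 into itself). Suppose there exist a sequence of integers n_k with |n_k| → ∞ and a constant C such that for every k the 2π-periodic function e^{i n_k (φ(t) − νt)} (for the integer ν with φ(t+2π) = φ(t) + 2πν) has absolutely convergent Fourier series with ‖e^{i n_k φ}‖_{A(𝕋)} ≤ C. Then φ is linear: there exists ν ∈ ℤ with φ(t) = νt + φ(0) for all t ∈ ℝ. -/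
open scoped Real
open Complex MeasureTheory Filter

open scoped ComplexConjugate Topology

lemma norm_exp_I_mul_intCast_mul (j : ℤ) (t : ℝ) : ‖exp (I * j * (t : ℂ))‖ = 1 := by
  have : I * j * (t : ℂ) = ((j * t : ℝ) : ℂ) * I := by push_cast; ring
  rw [this, Complex.norm_exp_ofReal_mul_I]

/-- On the unit circle, geometric sums centred at finitely many distinct points overlap in a
bounded way. -/
lemma exists_sum_norm_geom_sum_le (Z : Finset ℂ) (hZ : ∀ z ∈ Z, ‖z‖ = 1) :
    ∃ G : ℝ, ∀ (M : ℕ) (w : ℂ), ‖w‖ = 1 →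
      ∑ z ∈ Z, ‖∑ m ∈ Finset.range M, (conj z * w) ^ m‖ ≤ M + G := by
  classical
  obtain ⟨γ, hγ, hsep⟩ : ∃ γ : ℝ, 0 < γ ∧ ∀ x ∈ Z, ∀ y ∈ Z, x ≠ y → γ ≤ ‖x - y‖ := by
    rcases Z.offDiag.eq_empty_or_nonempty with h | h
    · refine ⟨1, one_pos, fun x hx y hy hxy => ?_⟩
      have : (x, y) ∈ Z.offDiag := by simp [hx, hy, hxy]
      simp [h] at this
    · obtain ⟨p, hp, hmin⟩ := Z.offDiag.exists_min_image (fun p => ‖p.1 - p.2‖) h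
      refine ⟨‖p.1 - p.2‖, ?_, fun x hx y hy hxy => hmin (x, y) (by simp [hx, hy, hxy])⟩
      exact norm_pos_iff.2 (sub_ne_zero.2 (Finset.mem_offDiag.1 hp).2.2)
  have hunit : ∀ z ∈ Z, ∀ w : ℂ, ‖w‖ = 1 → ‖conj z * w‖ = 1 := fun z hz w hw => by
    simp [hZ z hz, hw]
  have htriv : ∀ (M : ℕ), ∀ z ∈ Z, ∀ w : ℂ, ‖w‖ = 1 →
      ‖∑ m ∈ Finset.range M, (conj z * w) ^ m‖ ≤ M := fun M z hz w hw => by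
    refine (norm_sum_le _ _).trans ?_
    simp [hZ z hz, hw]
  have hfar : ∀ (M : ℕ), ∀ z ∈ Z, ∀ w : ℂ, ‖w‖ = 1 → γ / 2 ≤ ‖w - z‖ →
      ‖∑ m ∈ Finset.range M, (conj z * w) ^ m‖ ≤ 4 / γ := fun M z hz w hw hwz => by
    have hz1 : conj z * z = 1 := by
      rw [mul_comm, Complex.mul_conj, Complex.normSq_eq_norm_sq, hZ z hz]; simp
    have h1 : ‖conj z * w - 1‖ = ‖w - z‖ := by
      rw [← hz1, ← mul_sub, norm_mul, RCLike.norm_conj, hZ z hz, one_mul]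
    have h2 : ‖(conj z * w) ^ M - 1‖ ≤ 2 := by
      refine (norm_sub_le _ _).trans ?_
      rw [norm_pow, hunit z hz w hw]; norm_num
    rw [← mul_geom_sum, norm_mul, h1] at h2
    rw [le_div_iff₀ hγ]
    nlinarith [norm_nonneg (∑ m ∈ Finset.range M, (conj z * w) ^ m)]
  refine ⟨Z.card * (4 / γ), fun M w hw => ?_⟩
  by_cases hnear : ∃ z₀ ∈ Z, ‖w - z₀‖ < γ / 2
  · obtain ⟨z₀, hz₀, hlt⟩ := hnear
    rw [← Finset.add_sum_erase Z _ hz₀]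
    refine add_le_add (htriv M z₀ hz₀ w hw) ?_
    refine (Finset.sum_le_card_nsmul _ _ (4 / γ) fun z hz => ?_).trans ?_
    · obtain ⟨hne, hzZ⟩ := Finset.mem_erase.1 hz
      refine hfar M z hzZ w hw ?_
      have h1 := hsep z₀ hz₀ z hzZ hne.symm
      have h2 : ‖z₀ - z‖ ≤ ‖w - z₀‖ + ‖w - z‖ := by
        rw [norm_sub_rev w z₀]; exact norm_sub_le_norm_sub_add_norm_sub _ _ _
      linarith
    · rw [nsmul_eq_mul]
      exact mul_le_mul_of_nonneg_right (Nat.cast_le.2 (Finset.card_le_card (Z.erase_subset z₀)))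
        (by positivity)
  · push Not at hnear
    refine (Finset.sum_le_card_nsmul _ _ (4 / γ) fun z hz => hfar M z hz w hw (hnear z hz)).trans ?_
    rw [nsmul_eq_mul]
    linarith [Nat.cast_nonneg (α := ℝ) M]

/-- If the functions `F k` of modulus one have absolutely convergent Fourier series with norms
bounded by `C`, and look near each point `t` of `D` like an exponential with multiplier `u t`, then
`u` takes only finitely many values on `D`. -/
lemma finite_image_of_local_exponential {F : ℕ → ℝ → ℂ} {c : ℕ → ℤ → ℂ} {C : ℝ} {h : ℕ → ℝ}
    {D : Set ℝ} {u : ℝ → ℂ} (hF : ∀ k t, ‖F k t‖ = 1)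
    (hsum : ∀ k (t : ℝ), HasSum (fun j : ℤ => c k j * exp (I * j * t)) (F k t))
    (hc : ∀ k, Summable fun j => ‖c k j‖) (hC : ∀ k, ∑' j, ‖c k j‖ ≤ C)
    (hu : ∀ t, ‖u t‖ = 1)
    (hlim : ∀ m : ℕ, ∀ t ∈ D,
      Tendsto (fun k => conj (F k t) * F k (t + m * h k)) atTop (𝓝 (u t ^ m))) :
    (u '' D).Finite := by
  by_contra hinf
  obtain ⟨N, hN⟩ := exists_nat_gt C
  obtain ⟨Z, hZsub, hcard⟩ := Set.Infinite.exists_subset_card_eq hinf N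
  have hpre : ∀ z ∈ Z, ∃ t, t ∈ D ∧ u t = z := fun z hz => hZsub hz
  choose! τ hτ using hpre
  have hZ : ∀ z ∈ Z, ‖z‖ = 1 := fun z hz => by rw [← (hτ z hz).2, hu]
  obtain ⟨G, hG⟩ := exists_sum_norm_geom_sum_le Z hZ
  have key : ∀ M : ℕ, (N : ℝ) * M ≤ C * (M + G) := fun M => by
    have hlimS : Tendsto (fun k => ∑ z ∈ Z, ∑ m ∈ Finset.range M,
        conj z ^ m * (conj (F k (τ z)) * F k (τ z + m * h k))) atTop (𝓝 ((N : ℂ) * M)) := by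
      have : (N : ℂ) * M = ∑ z ∈ Z, ∑ m ∈ Finset.range M, conj z ^ m * z ^ m := by
        have hone : ∀ z ∈ Z, ∀ m : ℕ, conj z ^ m * z ^ m = 1 := fun z hz m => by
          rw [← mul_pow, mul_comm, Complex.mul_conj, Complex.normSq_eq_norm_sq, hZ z hz]; simp
        rw [Finset.sum_congr rfl fun z hz => Finset.sum_congr rfl fun m _ => hone z hz m]
        simp [hcard]
      rw [this]
      refine tendsto_finsetSum _ fun z hz => tendsto_finsetSum _ fun m _ => ?_
      have := hlim m (τ z) (hτ z hz).1
      rw [(hτ z hz).2] at this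
      exact this.const_mul _
    have hbd : ∀ k, ‖∑ z ∈ Z, ∑ m ∈ Finset.range M,
        conj z ^ m * (conj (F k (τ z)) * F k (τ z + m * h k))‖ ≤ C * (M + G) := fun k => by
      have hs : HasSum (fun j : ℤ => ∑ z ∈ Z, ∑ m ∈ Finset.range M,
          conj z ^ m * (conj (F k (τ z)) * (c k j * exp (I * j * ((τ z + m * h k : ℝ) : ℂ)))))
          (∑ z ∈ Z, ∑ m ∈ Finset.range M,
            conj z ^ m * (conj (F k (τ z)) * F k (τ z + m * h k))) :=
        hasSum_sum fun z _ => hasSum_sum fun m _ => ((hsum k _).mul_left _).mul_left _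
      have hle : ∀ j : ℤ, ‖∑ z ∈ Z, ∑ m ∈ Finset.range M,
          conj z ^ m * (conj (F k (τ z)) * (c k j * exp (I * j * ((τ z + m * h k : ℝ) : ℂ))))‖
          ≤ ‖c k j‖ * (M + G) := fun j => by
        have hw := norm_exp_I_mul_intCast_mul j (h k)
        have hfac : ∀ z ∈ Z, ∑ m ∈ Finset.range M,
            conj z ^ m * (conj (F k (τ z)) * (c k j * exp (I * j * ((τ z + m * h k : ℝ) : ℂ))))
            = c k j * (conj (F k (τ z)) * exp (I * j * (τ z : ℂ))) *
              ∑ m ∈ Finset.range M, (conj z * exp (I * j * (h k : ℂ))) ^ m := fun z _ => by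
          rw [Finset.mul_sum]
          refine Finset.sum_congr rfl fun m _ => ?_
          have : I * j * ((τ z + m * h k : ℝ) : ℂ) = I * j * (τ z : ℂ) + m * (I * j * (h k : ℂ)) := by
            push_cast; ring
          rw [this, Complex.exp_add, Complex.exp_nat_mul, mul_pow]
          ring
        rw [Finset.sum_congr rfl hfac]
        calc _ ≤ ∑ z ∈ Z, ‖c k j‖ *
              ‖∑ m ∈ Finset.range M, (conj z * exp (I * j * (h k : ℂ))) ^ m‖ := by
              refine (norm_sum_le _ _).trans (Finset.sum_le_sum fun z _ => ?_)
              rw [norm_mul, norm_mul, norm_mul, RCLike.norm_conj, hF,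
                norm_exp_I_mul_intCast_mul, one_mul, mul_one]
          _ ≤ ‖c k j‖ * (M + G) := by
              rw [← Finset.mul_sum]
              exact mul_le_mul_of_nonneg_left (hG M _ hw) (norm_nonneg _)
      refine (hs.norm_le_of_bounded ((hc k).hasSum.mul_right _) hle).trans ?_
      have hG0 : 0 ≤ (M : ℝ) + G :=
        (Finset.sum_nonneg fun z _ => norm_nonneg _).trans (hG M 1 norm_one)
      exact mul_le_mul_of_nonneg_right (hC k) hG0
    have := le_of_tendsto' hlimS.norm hbd
    simpa using this
  obtain ⟨M, hM⟩ := exists_nat_gt (C * G / (N - C))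
  rw [div_lt_iff₀ (by linarith)] at hM
  linarith [key M]

lemma fourierCoeff_lift_eq_fourierCoeffT [Fact (0 < 2 * π)] {f : ℝ → ℂ}
    (hf : Function.Periodic f (2 * π)) (j : ℤ) :
    fourierCoeff (T := 2 * π) hf.lift j = fourierCoeffT f j := by
  rw [fourierCoeff_eq_intervalIntegral _ _ 0, fourierCoeffT, zero_add, Complex.real_smul]
  push_cast
  congr 1
  refine intervalIntegral.integral_congr fun t _ => ?_
  have : (2 * π : ℂ) ≠ 0 := by exact_mod_cast Real.two_pi_pos.ne'
  simp only [fourier_coe_apply, Function.Periodic.lift_coe, smul_eq_mul]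
  rw [mul_comm]
  congr 2
  push_cast
  field_simp

/-- A continuous function with summable Fourier coefficients is the sum of its Fourier series. -/
lemma hasSum_fourierCoeffT {f : ℝ → ℂ} (hf : Function.Periodic f (2 * π)) (hcont : Continuous f)
    (hs : Summable fun j => ‖fourierCoeffT f j‖) (t : ℝ) :
    HasSum (fun j : ℤ => fourierCoeffT f j * exp (I * j * t)) (f t) := by
  have : Fact (0 < 2 * π) := ⟨Real.two_pi_pos⟩
  let v : C(AddCircle (2 * π), ℂ) := ⟨hf.lift, continuous_quot_lift _ hcont⟩
  have hco : ∀ j, fourierCoeff v j = fourierCoeffT f j := fourierCoeff_lift_eq_fourierCoeffT hf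
  have := has_pointwise_sum_fourier_series_of_summable (f := v)
    (by rw [funext hco]; exact hs.of_norm) (t : AddCircle (2 * π))
  have hne : (2 * π : ℂ) ≠ 0 := by exact_mod_cast Real.two_pi_pos.ne'
  convert! this using 2 with j
  rw [hco, smul_eq_mul, fourier_coe_apply]
  congr 2
  push_cast
  field_simp

lemma fourierCoeffT_const_mul_exp (a : ℂ) (k m : ℤ) :
    fourierCoeffT (fun t => a * exp (I * k * t)) m = if k = m then a else 0 := by
  have hne : (2 * π : ℂ) ≠ 0 := by exact_mod_cast Real.two_pi_pos.ne'
  have h : ∀ t : ℝ, a * exp (I * k * t) * exp (-I * m * t) = a * exp (I * (k - m) * t) := by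
    intro t
    rw [mul_assoc, ← Complex.exp_add]
    ring_nf
  simp only [fourierCoeffT, h, intervalIntegral.integral_const_mul]
  split_ifs with hkm
  · subst hkm
    simp
    field_simp
  · have hc : I * (k - m : ℂ) ≠ 0 :=
      mul_ne_zero I_ne_zero (sub_ne_zero.2 (by exact_mod_cast hkm))
    rw [integral_exp_mul_complex hc]
    have : I * (k - m) * ((2 * π : ℝ) : ℂ) = ((k - m : ℤ) : ℂ) * (2 * π * I) := by push_cast; ring
    rw [this, Complex.exp_int_mul_two_pi_mul_I]
    simp

/-- The `A(𝕋)` norm is at most the total mass of any expansion into exponentials. -/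
lemma sum_norm_fourierCoeffT_le {ι : Type*} [Countable ι] {a : ι → ℂ} {k : ι → ℤ} {h : ℝ → ℂ}
    (ha : Summable fun p => ‖a p‖) (hh : ∀ t : ℝ, HasSum (fun p => a p * exp (I * k p * t)) (h t))
    (J : Finset ℤ) : ∑ m ∈ J, ‖fourierCoeffT h m‖ ≤ ∑' p, ‖a p‖ := by
  have hco : ∀ m, HasSum (fun p => if k p = m then a p else 0) (fourierCoeffT h m) := by
    intro m
    simp_rw [← fourierCoeffT_const_mul_exp]
    refine HasSum.mul_left _ ?_
    refine intervalIntegral.hasSum_integral_of_dominated_convergence (fun p _ => ‖a p‖)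
      (fun p => by fun_prop) (fun p => ae_of_all _ fun t _ => ?_) (ae_of_all _ fun t _ => ha)
      intervalIntegrable_const (ae_of_all _ fun t _ => (hh t).mul_right _)
    have := norm_exp_I_mul_intCast_mul (-m) t
    rw [norm_mul, norm_mul, norm_exp_I_mul_intCast_mul, mul_one]
    rw [show -I * m * (t : ℂ) = I * ((-m : ℤ) : ℂ) * t by push_cast; ring, this, mul_one]
  have hsm : ∀ m, Summable fun p => if k p = m then ‖a p‖ else 0 := fun m =>
    ha.of_nonneg_of_le (fun p => by split_ifs <;> simp) (fun p => by split_ifs <;> simp)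
  calc ∑ m ∈ J, ‖fourierCoeffT h m‖
      ≤ ∑ m ∈ J, ∑' p, (if k p = m then ‖a p‖ else 0) := by
        refine Finset.sum_le_sum fun m _ => ?_
        refine (hco m).norm_le_of_bounded (hsm m).hasSum fun p => ?_
        split_ifs <;> simp
    _ = ∑' p, ∑ m ∈ J, (if k p = m then ‖a p‖ else 0) :=
        (Summable.tsum_finsetSum fun m _ => hsm m).symm
    _ ≤ ∑' p, ‖a p‖ := by
        refine Summable.tsum_le_tsum (fun p => ?_) (summable_sum fun m _ => hsm m) ha
        rw [Finset.sum_ite_eq]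
        split_ifs <;> simp

lemma sum_norm_fourierCoeffT_conj_mul_shift_le {f : ℝ → ℂ} {c : ℤ → ℂ}
    (hf : ∀ t : ℝ, HasSum (fun j : ℤ => c j * exp (I * j * t)) (f t))
    (hc : Summable fun j => ‖c j‖) (h : ℝ) (J : Finset ℤ) :
    ∑ m ∈ J, ‖fourierCoeffT (fun t => conj (f t) * f (t + h)) m‖ ≤ (∑' j, ‖c j‖) ^ 2 := by
  have h1 : Summable fun j => ‖conj (c j)‖ := by simpa using hc
  have h2 : ∀ j : ℤ, ‖c j * exp (I * j * (h : ℂ))‖ = ‖c j‖ := fun j => by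
    rw [norm_mul, norm_exp_I_mul_intCast_mul, mul_one]
  have h3 : Summable fun j : ℤ => ‖c j * exp (I * j * (h : ℂ))‖ := by simpa only [h2] using hc
  have hexp : ∀ t : ℝ, HasSum (fun p : ℤ × ℤ => conj (c p.1) * (c p.2 * exp (I * p.2 * (h : ℂ))) *
      exp (I * ((p.2 - p.1 : ℤ) : ℂ) * t)) (conj (f t) * f (t + h)) := fun t => by
    have e1 : HasSum (fun j : ℤ => conj (c j) * exp (I * ((-j : ℤ) : ℂ) * t)) (conj (f t)) := by
      convert! (Complex.hasSum_conj'.2 (hf t)) using 2 with j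
      rw [map_mul, ← Complex.exp_conj]
      simp
    have e2 := hf (t + h)
    have hsm := summable_mul_of_summable_norm
      (f := fun j : ℤ => conj (c j) * exp (I * ((-j : ℤ) : ℂ) * t))
      (g := fun j : ℤ => c j * exp (I * j * ((t + h : ℝ) : ℂ)))
      (by simpa only [norm_mul, norm_exp_I_mul_intCast_mul, mul_one] using h1)
      (by simpa only [norm_mul, norm_exp_I_mul_intCast_mul, mul_one] using hc)
    refine (e1.mul e2 hsm).congr_fun fun p => ?_
    have h' : I * p.2 * ((t + h : ℝ) : ℂ) = I * p.2 * h + I * p.2 * t := by push_cast; ring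
    have h'' : I * ((p.2 - p.1 : ℤ) : ℂ) * t = I * p.2 * t + I * ((-p.1 : ℤ) : ℂ) * t := by
      push_cast; ring
    rw [h', h'', Complex.exp_add, Complex.exp_add]
    ring
  refine (sum_norm_fourierCoeffT_le (h1.mul_norm h3) hexp J).trans_eq ?_
  rw [sq, tsum_mul_tsum_of_summable_norm (by simpa using hc) (by simpa using hc)]
  exact tsum_congr fun p => by rw [norm_mul, h2, RCLike.norm_conj]

/-- A bounded measurable periodic function with summable Fourier coefficients agrees almost
everywhere with a continuous function. -/
lemma exists_continuous_ae_eq_of_summable_fourierCoeffT {u : ℝ → ℂ}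
    (hu : Function.Periodic u (2 * π)) (hmeas : Measurable u) {B : ℝ} (hB : ∀ t, ‖u t‖ ≤ B)
    (hs : Summable fun j => ‖fourierCoeffT u j‖) :
    ∃ v : ℝ → ℂ, Continuous v ∧ ∀ᵐ t, v t = u t := by
  have : Fact (0 < 2 * π) := ⟨Real.two_pi_pos⟩
  have hUm : Measurable (hu.lift : AddCircle (2 * π) → ℂ) := measurable_from_quotient.2 hmeas
  have hUB : ∀ x : AddCircle (2 * π), ‖hu.lift x‖ ≤ B := fun x => by
    induction x using QuotientAddGroup.induction_on with
    | H t => exact hB t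
  have hmem : MemLp (hu.lift : AddCircle (2 * π) → ℂ) 2 AddCircle.haarAddCircle :=
    MemLp.of_bound hUm.aestronglyMeasurable B (ae_of_all _ hUB)
  have hco : ∀ j, fourierCoeff (hmem.toLp _) j = fourierCoeffT u j := fun j => by
    rw [← fourierCoeff_lift_eq_fourierCoeffT hu]
    refine integral_congr_ae ?_
    filter_upwards [hmem.coeFn_toLp] with x hx
    rw [hx]
  have hL2 := hasSum_fourier_series_L2 (hmem.toLp _)
  simp_rw [hco] at hL2
  have hsC : Summable fun j : ℤ => fourierCoeffT u j • (fourier j : C(AddCircle (2 * π), ℂ)) := by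
    refine .of_norm ?_
    simpa only [norm_smul, fourier_norm, mul_one] using hs
  obtain ⟨v, hv⟩ := hsC
  have hv' := (ContinuousMap.toLp (E := ℂ) 2 AddCircle.haarAddCircle ℂ).hasSum hv
  have heq := hL2.unique (by simpa only [Function.comp_def, map_smul] using hv')
  have hae : ∀ᵐ x ∂(volume : Measure (AddCircle (2 * π))), v x = hu.lift x := by
    rw [AddCircle.volume_eq_smul_haarAddCircle]
    refine Measure.ae_smul_measure ?_ _
    filter_upwards [hmem.coeFn_toLp, ContinuousMap.coeFn_toLp (𝕜 := ℂ) (p := 2)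
      AddCircle.haarAddCircle v] with x h1 h2
    rw [← h1, ← h2, heq]
  refine ⟨fun t => v t, by fun_prop, ?_⟩
  rw [← Measure.restrict_univ (μ := (volume : Measure ℝ)),
    ← iUnion_Ioc_add_zsmul Real.two_pi_pos 0, ae_restrict_iUnion_iff]
  intro m
  have hmp := AddCircle.measurePreserving_mk (2 * π) (0 + m • (2 * π))
  have := hmp.quasiMeasurePreserving.ae hae
  rw [add_smul, one_smul, ← add_assoc]
  exact this

lemma ae_eq_const_of_finite {u v : ℝ → ℂ} (hv : Continuous v) (huv : ∀ᵐ t, v t = u t) {S : Set ℂ}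
    (hS : S.Finite) (huS : ∀ᵐ t, u t ∈ S) : ∃ z, ∀ᵐ t, u t = z := by
  have hcl : IsClosed (v ⁻¹' S) := hS.isClosed.preimage hv
  have hae : ∀ᵐ t, t ∈ v ⁻¹' S := by
    filter_upwards [huv, huS] with t h1 h2
    simpa [h1] using h2
  have hall : v ⁻¹' S = Set.univ := by
    rw [← hcl.closure_eq]
    exact (Measure.dense_of_ae hae).closure_eq
  refine ⟨v 0, ?_⟩
  filter_upwards [huv] with t ht
  rw [← ht]
  exact isPreconnected_univ.constant_of_mapsTo hS.isDiscrete hv.continuousOn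
    (fun x _ => by rw [← Set.mem_preimage, hall]; trivial) (Set.mem_univ _) (Set.mem_univ _)

lemma exists_ae_eq_const_of_exp {g : ℝ → ℝ}
    (h : ∀ k : ℕ, ∃ z : ℂ, ∀ᵐ t, exp (I * ((1 / (k + 1) : ℝ) * g t : ℝ)) = z) :
    ∃ a, ∀ᵐ t, g t = a := by
  choose z hz using h
  have hall := ae_all_iff.2 hz
  obtain ⟨t₀, ht₀⟩ := hall.exists
  refine ⟨g t₀, ?_⟩
  filter_upwards [hall] with t ht
  obtain ⟨k, hk⟩ := exists_nat_gt (|g t| + |g t₀|)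
  have heq := (ht k).trans (ht₀ k).symm
  rw [mul_comm I, mul_comm I] at heq
  have hk1 : (0 : ℝ) < k + 1 := by positivity
  have hlt : ∀ x : ℝ, |x| ≤ |g t| + |g t₀| → |1 / (k + 1 : ℝ) * x| < 1 := fun x hx => by
    rw [abs_mul, abs_of_pos (by positivity), one_div, inv_mul_lt_one₀ hk1]
    linarith
  have h1 := abs_lt.1 (hlt (g t) (by linarith [abs_nonneg (g t₀)]))
  have h2 := abs_lt.1 (hlt (g t₀) (by linarith [abs_nonneg (g t)]))
  have := congrArg Complex.arg heq
  rw [Complex.arg_exp_mul_I, Complex.arg_exp_mul_I,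
    (toIocMod_eq_self _).2, (toIocMod_eq_self _).2] at this
  · exact mul_left_cancel₀ (by positivity) this
  all_goals
    constructor <;> linarith [Real.pi_gt_three]

theorem absolutely_continuous_case
    (φ : ℝ → ℝ)
    (hac : ∃ g : ℝ → ℝ, LocallyIntegrable g volume ∧
      ∀ t : ℝ, φ t = φ 0 + ∫ s in (0 : ℝ)..t, g s)
    (hper : ∃ ν : ℤ, ∀ t : ℝ, φ (t + 2 * π) = φ t + 2 * π * ν)
    (n : ℕ → ℤ) (hn : Tendsto (fun k : ℕ => |n k|) atTop atTop)
    (C : ℝ)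
    (hsum : ∀ k : ℕ, Summable fun j : ℤ =>
      ‖fourierCoeffT (fun t : ℝ => Complex.exp (Complex.I * (n k : ℂ) * (φ t : ℂ))) j‖)
    (hbound : ∀ k : ℕ,
      normAT (fun t : ℝ => Complex.exp (Complex.I * (n k : ℂ) * (φ t : ℂ))) ≤ C) :
    ∃ ν : ℤ, ∀ t : ℝ, φ t = ν * t + φ 0 := by
  obtain ⟨g, hg, hφg⟩ := hac
  obtain ⟨ν, hν⟩ := hper
  have hφ' : φ = fun t => φ 0 + ∫ s in (0 : ℝ)..t, g s := funext hφg
  have hφcont : Continuous φ := by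
    rw [hφ']
    refine continuous_const.add (intervalIntegral.continuous_primitive (fun a b => ?_) 0)
    exact intervalIntegrable_iff.2
      ((hg.integrableOn_isCompact isCompact_uIcc).mono_set Set.uIoc_subset_uIcc)
  have hderiv : ∀ᵐ t, HasDerivAt φ (g t) t := by
    filter_upwards [LocallyIntegrable.ae_hasDerivAt_integral hg] with t ht
    rw [hφ']
    exact (ht 0).const_add _
  let F : ℕ → ℝ → ℂ := fun k t => exp (I * (n k : ℂ) * (φ t : ℂ))
  have hFcont : ∀ k, Continuous (F k) := fun k => by fun_prop
  have hFnorm : ∀ k t, ‖F k t‖ = 1 := fun k t => norm_exp_I_mul_intCast_mul (n k) (φ t)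
  have hFper : ∀ k, Function.Periodic (F k) (2 * π) := fun k t => by
    have : I * (n k : ℂ) * (φ (t + 2 * π) : ℂ)
        = I * n k * φ t + ((n k * ν : ℤ) : ℂ) * (2 * π * I) := by
      rw [hν]; push_cast; ring
    simp only [F]
    rw [this, Complex.exp_add, Complex.exp_int_mul_two_pi_mul_I, mul_one]
  have hFsum : ∀ k (t : ℝ),
      HasSum (fun j : ℤ => fourierCoeffT (F k) j * exp (I * j * t)) (F k t) :=
    fun k => hasSum_fourierCoeffT (hFper k) (hFcont k) (hsum k)
  have hlocal : ∀ t, DifferentiableAt ℝ φ t → ∀ x : ℝ,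
      Tendsto (fun k => conj (F k t) * F k (t + x * (n k : ℝ)⁻¹)) atTop
        (𝓝 (exp (I * (x * deriv φ t : ℝ)))) := fun t ht x => by
    have hn' : Tendsto (fun k => ‖(n k : ℝ)‖) atTop atTop := by
      simp_rw [Real.norm_eq_abs, ← Int.cast_abs]
      exact tendsto_intCast_atTop_atTop.comp hn
    have hlim := ht.hasDerivAt.hasFDerivAt.lim x hn'
    have hcont : Continuous fun y : ℝ => exp (I * (y : ℂ)) := by fun_prop
    convert! (hcont.tendsto _).comp hlim using 1
    · funext k
      simp only [F, Function.comp_apply, ← Complex.exp_conj, ← Complex.exp_add, smul_eq_mul]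
      congr 1
      rw [mul_comm x]
      push_cast
      simp
      ring
  have hconst : ∀ s : ℝ, ∃ z : ℂ, ∀ᵐ t, exp (I * (s * deriv φ t : ℝ)) = z := fun s => by
    let u : ℝ → ℂ := fun t => exp (I * (s * deriv φ t : ℝ))
    have hunorm : ∀ t, ‖u t‖ = 1 := fun t => by
      simp only [u]
      rw [mul_comm, Complex.norm_exp_ofReal_mul_I]
    have humeas : Measurable u := by
      have := measurable_deriv φ
      fun_prop
    have huper : Function.Periodic u (2 * π) := fun t => by
      have : deriv φ (t + 2 * π) = deriv φ t := by
        rw [← deriv_comp_add_const, funext hν, deriv_add_const]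
      simp only [u, this]
    have hfin : (u '' {t | DifferentiableAt ℝ φ t}).Finite := by
      refine finite_image_of_local_exponential (h := fun k => s * (n k : ℝ)⁻¹)
        hFnorm hFsum hsum hbound hunorm fun m t ht => ?_
      convert! hlocal t ht (m * s) using 1
      · simp only [mul_assoc]
      · simp only [u]
        rw [← Complex.exp_nat_mul]
        congr 2
        push_cast
        ring
    have hcoeff : ∀ j, Tendsto
        (fun k => fourierCoeffT (fun t => conj (F k t) * F k (t + s * (n k : ℝ)⁻¹)) j) atTop
        (𝓝 (fourierCoeffT u j)) := fun j => by
      refine Tendsto.const_mul _ ?_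
      refine intervalIntegral.tendsto_integral_filter_of_dominated_convergence (fun _ => 1)
        (Eventually.of_forall fun k => ?_)
        (Eventually.of_forall fun k => ae_of_all _ fun t _ => ?_) intervalIntegrable_const ?_
      · have := hFcont k
        exact Continuous.aestronglyMeasurable (by fun_prop)
      · have := norm_exp_I_mul_intCast_mul (-j) t
        rw [norm_mul, norm_mul, RCLike.norm_conj, hFnorm, hFnorm,
          show -I * j * (t : ℂ) = I * ((-j : ℤ) : ℂ) * t by push_cast; ring, this]
        norm_num
      · filter_upwards [hderiv] with t ht _
        exact (hlocal t ht.differentiableAt s).mul_const _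
    have husum : Summable fun j => ‖fourierCoeffT u j‖ := by
      refine summable_of_sum_le (c := C ^ 2) (fun j => norm_nonneg _) fun J => ?_
      refine le_of_tendsto' (tendsto_finsetSum J fun j _ => (hcoeff j).norm) fun k => ?_
      refine (sum_norm_fourierCoeffT_conj_mul_shift_le (hFsum k) (hsum k) _ J).trans ?_
      exact pow_le_pow_left₀ (tsum_nonneg fun _ => norm_nonneg _) (hbound k) 2
    obtain ⟨v, hv, hvu⟩ := exists_continuous_ae_eq_of_summable_fourierCoeffT huper humeas
      (fun t => (hunorm t).le) husum
    refine ae_eq_const_of_finite hv hvu hfin ?_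
    filter_upwards [hderiv] with t ht
    exact Set.mem_image_of_mem u ht.differentiableAt
  obtain ⟨a, ha⟩ := exists_ae_eq_const_of_exp fun k => hconst _
  have hga : ∀ᵐ t, g t = a := by
    filter_upwards [ha, hderiv] with t h1 h2
    rw [← h1, h2.deriv]
  have hlin : ∀ t, φ t = φ 0 + t * a := fun t => by
    rw [hφg t, intervalIntegral.integral_congr_ae (g := fun _ => a) (hga.mono fun t ht _ => ht)]
    simp
  have haν : a = ν := by
    have := hν 0
    rw [hlin (0 + 2 * π), zero_add, add_right_inj] at this
    exact mul_left_cancel₀ Real.two_pi_pos.ne' this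
  exact ⟨ν, fun t => by rw [hlin t, haν]; ring⟩
end
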